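/- Let d ≥ 3. There exists u > 0 such that for every vacant-set law Q at level u, Q-almost surely the set {x ∈ ℤ² : Y_x = 1} contains an infinite nearest-neighbor connected component; that is, the vacant set of random interlacements at level u percolates inside the plane ℤ² for all sufficiently small u > 0. -/

import Mathlib

open MeasureTheory Filter

namespace RI

/-- Points of `ℤ^d`. -/
abbrev Zd (d : ℕ) := Fin d → ℤ

/-- `x` and `y` are nearest neighbours: `|x - y| = 1`. -/
def adj {d : ℕ} (x y : Zd d) : Prop := (∑ i, |x i - y i|) = 1

/-- `x` and `y` are `*`-neighbours: `|x - y|_∞ = 1`. -/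
def starAdj {d : ℕ} (x y : Zd d) : Prop := x ≠ y ∧ ∀ i, |x i - y i| ≤ 1

/-- `x` belongs to the plane `ℤ e₁ + ℤ e₂ ⊆ ℤ^d`. -/
def inPlane {d : ℕ} (x : Zd d) : Prop := ∀ i : Fin d, 2 ≤ (i : ℕ) → x i = 0

/-- The `k`-th coordinate of `x`, with value `0` for out-of-range indices. -/
def coord {d : ℕ} (x : Zd d) (k : ℕ) : ℤ := if h : k < d then x ⟨k, h⟩ else 0

/-- `P` is the family of laws of the simple random walks on `ℤ^d` started at the points of
`ℤ^d`: each `P x` is a probability measure on the path space `ℕ → ℤ^d`, and the cylinder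
probabilities are those of the walk with i.i.d. increments uniform on `{± e_i}`. -/
def IsSRW (d : ℕ) (P : Zd d → Measure (ℕ → Zd d)) : Prop :=
  (∀ x, IsProbabilityMeasure (P x)) ∧
  (∀ (x : Zd d) (n : ℕ) (w : ℕ → Zd d),
      (w 0 = x ∧ ∀ k < n, adj (w k) (w (k + 1))) →
        P x {ω | ∀ k ≤ n, ω k = w k} = ((2 * d : ENNReal))⁻¹ ^ n) ∧
  (∀ (x : Zd d) (n : ℕ) (w : ℕ → Zd d),
      ¬(w 0 = x ∧ ∀ k < n, adj (w k) (w (k + 1))) →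
        P x {ω | ∀ k ≤ n, ω k = w k} = 0)

/-- The equilibrium measure of a set `V ⊆ ℤ^d`:
`e_V(x) = P_x[H̃_V = ∞]` for `x ∈ V`, and `0` otherwise. -/
noncomputable def eqm {d : ℕ} (P : Zd d → Measure (ℕ → Zd d)) (V : Set (Zd d)) : Zd d → ℝ :=
  V.indicator fun x => (P x {ω | ∀ n, 1 ≤ n → ω n ∉ V}).toReal

/-- The capacity of a finite set `K ⊆ ℤ^d`. -/
noncomputable def capa {d : ℕ} (P : Zd d → Measure (ℕ → Zd d)) (K : Finset (Zd d)) : ℝ :=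
  ∑ x ∈ K, eqm P (↑K) x

/-- `Q` is a vacant-set law at level `u`: a probability measure on `{0,1}^{ℤ^d}`
(with `true = 1` standing for "vacant") such that
`Q[Y_x = 1 ∀ x ∈ K] = exp(-u cap K)` for every finite `K`. -/
def IsVacantLaw {d : ℕ} (P : Zd d → Measure (ℕ → Zd d)) (u : ℝ)
    (Q : Measure (Zd d → Bool)) : Prop :=
  IsProbabilityMeasure Q ∧
  ∀ K : Finset (Zd d),
    Q {Y | ∀ x ∈ K, Y x = true} = ENNReal.ofReal (Real.exp (-(u * capa P K)))

/-- There is a `*`-path starting in `S`, ending in `T`, all of whose points lie in `A`. -/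
def HasStarPath {d : ℕ} (S T A : Set (Zd d)) : Prop :=
  ∃ (N : ℕ) (w : ℕ → Zd d), w 0 ∈ S ∧ w N ∈ T ∧ (∀ k ≤ N, w k ∈ A) ∧
    ∀ k < N, starAdj (w k) (w (k + 1))

/-- Interior boundary `∂_int U`. -/
def intBdry {d : ℕ} (U : Set (Zd d)) : Set (Zd d) := {x | x ∈ U ∧ ∃ y, y ∉ U ∧ adj x y}

/-- (Exterior) boundary `∂U`. -/
def bdry {d : ℕ} (U : Set (Zd d)) : Set (Zd d) := {x | x ∉ U ∧ ∃ y ∈ U, adj x y}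

/-- `ℓ = 100 ⌊L^{1/100}⌋ + 1`. -/
noncomputable def ellOf (L : ℕ) : ℕ := 100 * ⌊(L : ℝ) ^ ((1 : ℝ) / 100)⌋₊ + 1

/-- The scales `L_{n+1} = ℓ_n L_n`. -/
noncomputable def Lseq (L0 : ℕ) : ℕ → ℕ
  | 0 => L0
  | n + 1 => ellOf (Lseq L0 n) * Lseq L0 n

/-- The levels `u_{n+1} = (1 + 1/log L_n)⁻¹ u_n`. -/
noncomputable def useq (L0 : ℕ) (u0 : ℝ) : ℕ → ℝ
  | 0 => u0
  | n + 1 => (1 + 1 / Real.log (Lseq L0 n))⁻¹ * useq L0 u0 n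

/-- The event (on the configuration space `{0,1}^{ℤ^d}`) that there is a `*`-path from
`[-L,L]² ∩ ℤ²` to `∂_int ([-3L,3L]^d ∩ ℤ^d)` all of whose points lie in `{x ∈ ℤ² : Y_x = 0}`. -/
def qEvent (d : ℕ) (L : ℕ) : Set (Zd d → Bool) :=
  {Y | HasStarPath
    {x : Zd d | inPlane x ∧ ∀ i, |x i| ≤ (L : ℤ)}
    (intBdry {x : Zd d | ∀ i, |x i| ≤ (3 * L : ℤ)})
    {x : Zd d | inPlane x ∧ Y x = false}}


/-- The nearest-neighbour connected component of `x` inside `S`. -/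
def component {d : ℕ} (S : Set (Zd d)) (x : Zd d) : Set (Zd d) :=
  {y | Relation.ReflTransGen (fun a b => adj a b ∧ a ∈ S ∧ b ∈ S) x y}

end RI

open RI MeasureTheory Filter

namespace RI

section Walk

variable {d : ℕ}

/-- The step of the walk indexed by a direction and a sign. -/
def step (s : Fin d × Bool) : Zd d := Pi.single s.1 (if s.2 then 1 else -1)

/-- The averaging operator of the simple random walk. -/
noncomputable def avg (f : Zd d → ℝ) (x : Zd d) : ℝ :=
  (2 * d : ℝ)⁻¹ * ∑ s : Fin d × Bool, f (x + step s)

/-- The path that starts at `x` and continues with `ω`. -/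
def consPath (x : Zd d) (ω : ℕ → Zd d) : ℕ → Zd d
  | 0 => x
  | n + 1 => ω n

lemma step_injective : Function.Injective (step : Fin d × Bool → Zd d) := by
  rintro ⟨i, b⟩ ⟨j, c⟩ h
  have hi := congrFun h i
  simp only [step, Pi.single_eq_same, Pi.single_apply] at hi
  by_cases hij : i = j
  · subst hij
    cases b <;> cases c <;> simp_all
  · rw [if_neg hij] at hi
    cases b <;> simp at hi

lemma step_neg (s : Fin d × Bool) : step (s.1, !s.2) = -step s := by
  obtain ⟨i, b⟩ := s
  cases b <;> simp [step, ← Pi.single_neg]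

lemma adj_add_step (x : Zd d) (s : Fin d × Bool) : adj x (x + step s) := by
  obtain ⟨i, b⟩ := s
  unfold adj
  rw [Finset.sum_eq_single i]
  · cases b <;> simp [step]
  · intro j _ hj
    simp [step, hj]
  · simp

lemma exists_step_of_adj {x y : Zd d} (h : adj x y) : ∃ s, y = x + step s := by
  unfold adj at h
  have h0 : ∃ i, x i - y i ≠ 0 := by
    by_contra! hc
    simp [hc] at h
  obtain ⟨i, hi⟩ := h0
  have hsplit := Finset.add_sum_erase Finset.univ (fun i => |x i - y i|) (Finset.mem_univ i)
  have hpos : 1 ≤ |x i - y i| := Int.one_le_abs hi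
  have hnn : 0 ≤ ∑ j ∈ Finset.univ.erase i, |x j - y j| :=
    Finset.sum_nonneg fun _ _ => abs_nonneg _
  have hz : ∑ j ∈ Finset.univ.erase i, |x j - y j| = 0 := by
    omega
  have h1 : |x i - y i| = 1 := by omega
  rw [Finset.sum_eq_zero_iff_of_nonneg fun _ _ => abs_nonneg _] at hz
  have hz' : ∀ j, j ≠ i → x j = y j := fun j hj => by
    have := hz j (by simp [hj])
    rw [abs_eq_zero] at this
    omega
  rcases (abs_eq (by norm_num : (0 : ℤ) ≤ 1)).1 h1 with h2 | h2
  · refine ⟨(i, false), funext fun j => ?_⟩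
    by_cases hj : j = i
    · subst hj; simp [step]; omega
    · simp [step, hj, hz' j hj]
  · refine ⟨(i, true), funext fun j => ?_⟩
    by_cases hj : j = i
    · subst hj; simp [step]; omega
    · simp [step, hj, hz' j hj]

lemma measurable_consPath (x : Zd d) : Measurable (consPath x) := by
  rw [measurable_pi_iff]
  intro n
  cases n with
  | zero => exact measurable_const
  | succ n => exact measurable_pi_apply n

/-- The path cylinders. -/
def cylinder (n : ℕ) (w : ℕ → Zd d) : Set (ℕ → Zd d) := {ω | ∀ k ≤ n, ω k = w k}

lemma measurableSet_cylinder (n : ℕ) (w : ℕ → Zd d) : MeasurableSet (cylinder n w) := by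
  have : cylinder n w = ⋂ k, ⋂ (_ : k ≤ n), (fun ω : ℕ → Zd d => ω k) ⁻¹' {w k} := by
    ext ω; simp [cylinder]
  rw [this]
  exact MeasurableSet.iInter fun k => MeasurableSet.iInter fun _ =>
    measurable_pi_apply k (MeasurableSet.singleton _)

lemma isPiSystem_cylinder :
    IsPiSystem {A : Set (ℕ → Zd d) | ∃ n w, A = cylinder n w} := by
  rintro _ ⟨n, w, rfl⟩ _ ⟨m, v, rfl⟩ ⟨ω, h1, h2⟩
  refine ⟨max n m, ω, ?_⟩
  ext η
  simp only [cylinder, Set.mem_inter_iff, Set.mem_ofPred_eq] at *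
  constructor
  · rintro ⟨a, b⟩ k hk
    rcases le_max_iff.1 hk with hk | hk
    · rw [a k hk, h1 k hk]
    · rw [b k hk, h2 k hk]
  · intro a
    exact ⟨fun k hk => by rw [a k (le_max_of_le_left hk), h1 k hk],
      fun k hk => by rw [a k (le_max_of_le_right hk), h2 k hk]⟩

lemma generateFrom_cylinder :
    (inferInstance : MeasurableSpace (ℕ → Zd d)) =
      MeasurableSpace.generateFrom {A | ∃ n w, A = cylinder n w} := by
  apply le_antisymm
  · refine iSup_le fun k => ?_
    rw [← measurable_iff_comap_le]
    intro B _
    have : (fun ω : ℕ → Zd d => ω k) ⁻¹' B =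
        ⋃ v : {v : Fin (k + 1) → Zd d // v (Fin.last k) ∈ B},
          cylinder k (fun m => if h : m < k + 1 then v.1 ⟨m, h⟩ else 0) := by
      ext ω
      simp only [Set.mem_preimage, Set.mem_iUnion, cylinder, Set.mem_ofPred_eq]
      constructor
      · intro h
        exact ⟨⟨fun m => ω m, by simpa using h⟩, fun m hm => by simp [Nat.lt_succ_of_le hm]⟩
      · rintro ⟨⟨v, hv⟩, h⟩
        have := h k le_rfl
        simp only [Nat.lt_succ_self, dite_true] at this
        rw [this]
        exact hv
    rw [this]
    exact MeasurableSet.iUnion fun v => MeasurableSpace.measurableSet_generateFrom ⟨_, _, rfl⟩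
  · refine MeasurableSpace.generateFrom_le ?_
    rintro _ ⟨n, w, rfl⟩
    exact measurableSet_cylinder n w

/-- The simple Markov property at time one. -/
lemma IsSRW.eq_sum_map {P : Zd d → Measure (ℕ → Zd d)} (hd : d ≠ 0) (hP : IsSRW d P) (x : Zd d) :
    P x = ∑ s : Fin d × Bool, (2 * d : ENNReal)⁻¹ • (P (x + step s)).map (consPath x) := by
  obtain ⟨hprob, hpos, hzero⟩ := hP
  have hd0 : (2 * d : ENNReal) ≠ 0 := by simp [hd]
  have hdt : (2 * d : ENNReal) ≠ ⊤ := ENNReal.mul_ne_top (by simp) (by simp)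
  have hone : ∑ _s : Fin d × Bool, (2 * d : ENNReal)⁻¹ = 1 := by
    rw [Finset.sum_const, Finset.card_univ, Fintype.card_prod, Fintype.card_fin, Fintype.card_bool,
      nsmul_eq_mul]
    push_cast
    rw [mul_comm (d : ENNReal) 2]
    exact ENNReal.mul_inv_cancel hd0 hdt
  have := hprob x
  refine ext_of_generate_finite _ generateFrom_cylinder isPiSystem_cylinder ?_ ?_
  · rintro _ ⟨n, w, rfl⟩
    rw [Measure.finsetSum_apply]
    simp only [Measure.smul_apply, smul_eq_mul]
    simp only [Measure.map_apply (measurable_consPath x) (measurableSet_cylinder n w)]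
    cases n with
    | zero =>
      by_cases hw : w 0 = x
      · have h1 := hpos x 0 w ⟨hw, by simp⟩
        have h2 : consPath x ⁻¹' (cylinder 0 w) = Set.univ := by
          ext ω; simp [cylinder, consPath, hw]
        simp only [h2, measure_univ, mul_one]
        rw [hone]
        simpa [cylinder] using h1
      · have h1 := hzero x 0 w (by simp [hw])
        have h2 : consPath x ⁻¹' (cylinder 0 w) = ∅ := by
          ext ω; simp [cylinder, consPath, Ne.symm hw]
        simp only [h2, measure_empty, mul_zero, Finset.sum_const_zero]
        exact h1
    | succ n =>
      have hpre : ∀ s : Fin d × Bool, w 0 = x →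
          consPath x ⁻¹' (cylinder (n + 1) w) = cylinder n (fun k => w (k + 1)) := by
        intro s hw
        ext ω
        simp only [Set.mem_preimage, cylinder, Set.mem_ofPred_eq]
        constructor
        · intro h k hk
          exact h (k + 1) (by omega)
        · intro h k hk
          cases k with
          | zero => exact hw.symm
          | succ k => exact h k (by omega)
      by_cases hw : w 0 = x ∧ ∀ k < n + 1, adj (w k) (w (k + 1))
      · rw [show P x (cylinder (n + 1) w) = _ from hpos x (n + 1) w hw]
        obtain ⟨s₀, hs₀⟩ := exists_step_of_adj (hw.2 0 (by omega))
        rw [hw.1] at hs₀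
        rw [Finset.sum_eq_single s₀]
        · rw [hpre s₀ hw.1]
          rw [show P (x + step s₀) (cylinder n fun k => w (k + 1)) = _ from
            hpos (x + step s₀) n (fun k => w (k + 1))
              ⟨hs₀, fun k hk => hw.2 (k + 1) (by omega)⟩]
          rw [pow_succ, mul_comm]
        · intro s _ hs
          rw [hpre s hw.1]
          rw [show P (x + step s) (cylinder n fun k => w (k + 1)) = _ from
            hzero (x + step s) n (fun k => w (k + 1)) (fun h => hs (step_injective
              (add_left_cancel (h.1.symm.trans hs₀))))]
          simp
        · simp
      · rw [show P x (cylinder (n + 1) w) = _ from hzero x (n + 1) w hw]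
        symm
        refine Finset.sum_eq_zero fun s _ => ?_
        by_cases hw0 : w 0 = x
        · rw [hpre s hw0]
          rw [show P (x + step s) (cylinder n fun k => w (k + 1)) = _ from
            hzero (x + step s) n (fun k => w (k + 1)) ?_, mul_zero]
          rintro ⟨h1, h2⟩
          refine hw ⟨hw0, fun k hk => ?_⟩
          cases k with
          | zero => rw [hw0, show w (0 + 1) = x + step s from h1]; exact adj_add_step x s
          | succ k => exact h2 k (by omega)
        · have h2 : consPath x ⁻¹' (cylinder (n + 1) w) = ∅ := by
            ext ω
            simp only [Set.mem_preimage, cylinder, Set.mem_ofPred_eq, Set.mem_empty_iff_false,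
              iff_false]
            intro h
            exact hw0 (h 0 (by omega)).symm
          simp [h2]
  · rw [Measure.finsetSum_apply]
    simp only [Measure.smul_apply, smul_eq_mul]
    simp only [Measure.map_apply (measurable_consPath x) MeasurableSet.univ, Set.preimage_univ]
    have : ∀ s : Fin d × Bool, P (x + step s) Set.univ = 1 := fun s =>
      (hprob (x + step s)).measure_univ
    simp only [this, mul_one, hone, measure_univ]

lemma IsSRW.lintegral_eq {P : Zd d → Measure (ℕ → Zd d)} (hd : d ≠ 0) (hP : IsSRW d P) (x : Zd d)
    {g : (ℕ → Zd d) → ENNReal} (hg : Measurable g) :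
    ∫⁻ ω, g ω ∂P x =
      (2 * d : ENNReal)⁻¹ * ∑ s : Fin d × Bool, ∫⁻ ω, g (consPath x ω) ∂P (x + step s) := by
  conv_lhs => rw [hP.eq_sum_map hd x]
  rw [lintegral_finsetSum_measure, Finset.mul_sum]
  refine Finset.sum_congr rfl fun s _ => ?_
  rw [lintegral_smul_measure, lintegral_map hg (measurable_consPath x), smul_eq_mul]

lemma IsSRW.measureReal_eq {P : Zd d → Measure (ℕ → Zd d)} (hd : d ≠ 0) (hP : IsSRW d P)
    (x : Zd d) {A : Set (ℕ → Zd d)} (hA : MeasurableSet A) {B : Set (ℕ → Zd d)}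
    (hB : consPath x ⁻¹' A = B) :
    (P x).real A = avg (fun y => (P y).real B) x := by
  have hprob := hP.1
  subst hB
  unfold avg Measure.real
  conv_lhs => rw [hP.eq_sum_map hd x]
  rw [Measure.finsetSum_apply, ENNReal.toReal_sum, Finset.mul_sum]
  · refine Finset.sum_congr rfl fun s _ => ?_
    rw [Measure.smul_apply, smul_eq_mul, Measure.map_apply (measurable_consPath x) hA,
      ENNReal.toReal_mul]
    simp
  · intro s _
    rw [Measure.smul_apply, smul_eq_mul, Measure.map_apply (measurable_consPath x) hA]
    exact ENNReal.mul_ne_top (by simp [hd]) (measure_ne_top _ _)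

end Walk

section Sweeping

variable {d : ℕ}

/-- The event of hitting `V` before leaving `B`. -/
def hitIn (B V : Set (Zd d)) : Set (ℕ → Zd d) := {ω | ∃ n, ω n ∈ V ∧ ∀ k ≤ n, ω k ∈ B}

/-- The event of hitting `V`. -/
def hit (V : Set (Zd d)) : Set (ℕ → Zd d) := {ω | ∃ n, ω n ∈ V}

lemma measurableSet_eval_mem (n : ℕ) (V : Set (Zd d)) :
    MeasurableSet {ω : ℕ → Zd d | ω n ∈ V} :=
  measurable_pi_apply n (MeasurableSet.of_discrete : MeasurableSet V)

lemma measurableSet_hitIn (B V : Set (Zd d)) : MeasurableSet (hitIn B V) := by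
  have : hitIn B V = ⋃ n, ({ω : ℕ → Zd d | ω n ∈ V} ∩ ⋂ k, ⋂ (_ : k ≤ n), {ω | ω k ∈ B}) := by
    ext ω; simp [hitIn]
  rw [this]
  exact MeasurableSet.iUnion fun n => (measurableSet_eval_mem n V).inter
    (MeasurableSet.iInter fun k => MeasurableSet.iInter fun _ => measurableSet_eval_mem k B)

lemma measurableSet_hit (V : Set (Zd d)) : MeasurableSet (hit V) := by
  have : hit V = ⋃ n, {ω : ℕ → Zd d | ω n ∈ V} := by
    ext ω; simp [hit]
  rw [this]
  exact MeasurableSet.iUnion fun n => measurableSet_eval_mem n V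

lemma preimage_hitIn_of_notMem {B : Set (Zd d)} (V : Set (Zd d)) {x : Zd d} (hx : x ∉ B) :
    consPath x ⁻¹' hitIn B V = ∅ := by
  ext ω
  simp only [hitIn, Set.mem_preimage, Set.mem_ofPred_eq, Set.mem_empty_iff_false, iff_false]
  rintro ⟨n, -, h⟩
  exact hx (h 0 (Nat.zero_le n))

lemma preimage_hitIn_of_mem {B V : Set (Zd d)} {x : Zd d} (hB : x ∈ B) (hV : x ∈ V) :
    consPath x ⁻¹' hitIn B V = Set.univ := by
  ext ω
  simp only [hitIn, Set.mem_preimage, Set.mem_ofPred_eq, Set.mem_univ, iff_true]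
  refine ⟨0, hV, fun k hk => ?_⟩
  obtain rfl : k = 0 := by omega
  exact hB

lemma preimage_hitIn_of_mem_of_notMem {B V : Set (Zd d)} {x : Zd d} (hB : x ∈ B) (hV : x ∉ V) :
    consPath x ⁻¹' hitIn B V = hitIn B V := by
  ext ω
  simp only [hitIn, Set.mem_preimage, Set.mem_ofPred_eq]
  constructor
  · rintro ⟨n, h1, h2⟩
    cases n with
    | zero => exact absurd h1 hV
    | succ n => exact ⟨n, h1, fun k hk => h2 (k + 1) (by omega)⟩
  · rintro ⟨n, h1, h2⟩
    refine ⟨n + 1, h1, fun k hk => ?_⟩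
    cases k with
    | zero => exact hB
    | succ k => exact h2 k (by omega)

lemma avg_const (hd : d ≠ 0) (c : ℝ) (x : Zd d) : avg (fun _ => c) x = c := by
  unfold avg
  rw [Finset.sum_const, Finset.card_univ, Fintype.card_prod, Fintype.card_fin, Fintype.card_bool,
    nsmul_eq_mul]
  push_cast
  have : (d : ℝ) ≠ 0 := by exact_mod_cast hd
  field_simp

lemma sum_mul_avg_comm (B : Finset (Zd d)) (f g : Zd d → ℝ) (hf : ∀ x ∉ B, f x = 0)
    (hg : ∀ x ∉ B, g x = 0) :
    ∑ x ∈ B, f x * avg g x = ∑ x ∈ B, g x * avg f x := by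
  have key : ∀ f g : Zd d → ℝ, (∀ x ∉ B, g x = 0) → ∑ x ∈ B, f x * avg g x =
      (2 * d : ℝ)⁻¹ * ∑ x ∈ B, ∑ y ∈ B, ∑ s : Fin d × Bool,
        if x + step s = y then f x * g y else 0 := by
    intro f g hg
    rw [Finset.mul_sum]
    refine Finset.sum_congr rfl fun x _ => ?_
    unfold avg
    rw [mul_left_comm, Finset.sum_comm, Finset.mul_sum]
    congr 1
    refine Finset.sum_congr rfl fun s _ => ?_
    rw [Finset.sum_ite_eq]
    split_ifs with h
    · rfl
    · rw [hg _ h, mul_zero]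
  rw [key f g hg, key g f hf, Finset.sum_comm]
  congr 1
  refine Finset.sum_congr rfl fun x _ => Finset.sum_congr rfl fun y _ => ?_
  let e : Fin d × Bool ≃ Fin d × Bool := Equiv.prodCongr (Equiv.refl _) Equiv.boolNot
  refine Fintype.sum_equiv e _ _ fun s => ?_
  have he : step (e s) = -step s := step_neg s
  have hiff : y + step s = x ↔ x + step (e s) = y := by
    rw [he, ← sub_eq_add_neg, sub_eq_iff_eq_add, eq_comm]
  simp only [hiff, mul_comm]

variable {P : Zd d → Measure (ℕ → Zd d)}

lemma sum_killed_eqm_mul (hd : d ≠ 0) (hP : IsSRW d P) {S X B : Finset (Zd d)} (hSX : S ⊆ X)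
    (hXB : X ⊆ B) :
    ∑ x ∈ X, (1 - avg (fun y => (P y).real (hitIn B X)) x) * (P x).real (hitIn B S) =
      ∑ x ∈ S, (1 - avg (fun y => (P y).real (hitIn B S)) x) := by
  have hprob := hP.1
  have h0 : ∀ V : Finset (Zd d), ∀ x ∉ B, (P x).real (hitIn (B : Set (Zd d)) V) = 0 := by
    intro V x hx
    rw [hP.measureReal_eq hd x (measurableSet_hitIn _ _)
      (preimage_hitIn_of_notMem _ (by simpa using hx))]
    simp [avg]
  have h1 : ∀ V : Finset (Zd d), V ⊆ B → ∀ x ∈ V, (P x).real (hitIn (B : Set (Zd d)) V) = 1 := by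
    intro V hV x hx
    rw [hP.measureReal_eq hd x (measurableSet_hitIn _ _)
      (preimage_hitIn_of_mem (by simpa using hV hx) (by simpa using hx))]
    simp [avg_const hd]
  have h2 : ∀ V : Finset (Zd d), ∀ x ∈ B, x ∉ V → (P x).real (hitIn (B : Set (Zd d)) V) =
      avg (fun y => (P y).real (hitIn B V)) x := by
    intro V x hx hxV
    exact hP.measureReal_eq hd x (measurableSet_hitIn _ _)
      (preimage_hitIn_of_mem_of_notMem (by simpa using hx) (by simpa using hxV))
  set f : Zd d → ℝ := fun y => (P y).real (hitIn (B : Set (Zd d)) X) with hf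
  set g : Zd d → ℝ := fun y => (P y).real (hitIn (B : Set (Zd d)) S) with hg
  have hsym := sum_mul_avg_comm B f g (h0 X) (h0 S)
  calc ∑ x ∈ X, (1 - avg f x) * g x = ∑ x ∈ X, (f x - avg f x) * g x :=
        Finset.sum_congr rfl fun x hx => by rw [show f x = 1 from h1 X hXB x hx]
    _ = ∑ x ∈ B, (f x - avg f x) * g x := by
        refine Finset.sum_subset hXB fun x hx hxX => ?_
        rw [show f x = avg f x from h2 X x hx hxX, sub_self, zero_mul]
    _ = ∑ x ∈ B, f x * (g x - avg g x) := by
        simp only [sub_mul, mul_sub, Finset.sum_sub_distrib, hsym]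
        congr 1
        exact Finset.sum_congr rfl fun x _ => mul_comm _ _
    _ = ∑ x ∈ S, f x * (g x - avg g x) := by
        symm
        refine Finset.sum_subset (hSX.trans hXB) fun x hx hxX => ?_
        rw [show g x = avg g x from h2 S x hx hxX, sub_self, mul_zero]
    _ = ∑ x ∈ S, (1 - avg g x) := Finset.sum_congr rfl fun x hx => by
        rw [show f x = 1 from h1 X hXB x (hSX hx),
          show g x = 1 from h1 S (hSX.trans hXB) x hx, one_mul]

lemma eqm_eq (hd : d ≠ 0) (hP : IsSRW d P) {V : Set (Zd d)} {x : Zd d} (hx : x ∈ V) :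
    eqm P V x = 1 - avg (fun y => (P y).real (hit V)) x := by
  have hprob := hP.1
  unfold eqm
  rw [Set.indicator_of_mem hx]
  have hset : {ω : ℕ → Zd d | ∀ n, 1 ≤ n → ω n ∉ V} = {ω | ∃ n, ω (n + 1) ∈ V}ᶜ := by
    ext ω
    simp only [Set.mem_ofPred_eq, Set.mem_compl_iff, not_exists]
    constructor
    · intro h n
      exact h (n + 1) (by omega)
    · intro h n hn
      obtain ⟨m, rfl⟩ : ∃ m, n = m + 1 := ⟨n - 1, by omega⟩
      exact h m
  have hmeas : MeasurableSet {ω : ℕ → Zd d | ∃ n, ω (n + 1) ∈ V} := by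
    rw [Set.ofPred_exists]
    exact MeasurableSet.iUnion fun n => measurableSet_eval_mem (n + 1) V
  change (P x).real _ = _
  rw [hset, probReal_compl_eq_one_sub hmeas, hP.measureReal_eq hd x hmeas rfl]
  rfl

/-- The finite boxes exhausting `ℤ^d`. -/
noncomputable def box (d n : ℕ) : Finset (Zd d) := Finset.Icc (fun _ => -(n : ℤ)) (fun _ => (n : ℤ))

lemma mem_box {n : ℕ} {x : Zd d} : x ∈ box d n ↔ ∀ i, |x i| ≤ n := by
  simp only [box, Finset.mem_Icc, Pi.le_def, abs_le, forall_and]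

lemma box_mono : Monotone (box d) := fun n m h x hx => by
  rw [mem_box] at *
  exact fun i => (hx i).trans (by exact_mod_cast h)

lemma exists_subset_box (A : Finset (Zd d)) : ∃ n, A ⊆ box d n := by
  refine ⟨∑ x ∈ A, ∑ i, (x i).natAbs, fun x hx => mem_box.2 fun i => ?_⟩
  have h1 : (x i).natAbs ≤ ∑ i, (x i).natAbs :=
    Finset.single_le_sum (f := fun i => (x i).natAbs) (fun _ _ => Nat.zero_le _)
      (Finset.mem_univ i)
  have h2 : ∑ i, (x i).natAbs ≤ ∑ x ∈ A, ∑ i, (x i).natAbs :=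
    Finset.single_le_sum (f := fun x : Zd d => ∑ i, (x i).natAbs) (fun _ _ => Nat.zero_le _) hx
  rw [Int.abs_eq_natAbs]
  omega

lemma tendsto_hitIn_box (hP : IsSRW d P) (V : Set (Zd d)) (x : Zd d) :
    Tendsto (fun n => (P x).real (hitIn (box d n : Set (Zd d)) V)) atTop
      (nhds ((P x).real (hit V))) := by
  have hprob := hP.1
  have hU : hit V = ⋃ n, hitIn (box d n : Set (Zd d)) V := by
    ext ω
    simp only [hit, hitIn, Set.mem_ofPred_eq, Set.mem_iUnion]
    constructor
    · rintro ⟨n, hn⟩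
      obtain ⟨m, hm⟩ := exists_subset_box ((Finset.range (n + 1)).image ω)
      exact ⟨m, n, hn, fun k hk => hm (Finset.mem_image_of_mem _ (by simp; omega))⟩
    · rintro ⟨m, n, hn, -⟩
      exact ⟨n, hn⟩
  rw [hU]
  refine (ENNReal.tendsto_toReal (measure_ne_top _ _)).comp
    (tendsto_measure_iUnion_atTop fun n m h ω => ?_)
  rintro ⟨k, hk, hB⟩
  exact ⟨k, hk, fun j hj => box_mono h (hB j hj)⟩

lemma tendsto_avg {f : ℕ → Zd d → ℝ} {g : Zd d → ℝ}
    (h : ∀ x, Tendsto (fun n => f n x) atTop (nhds (g x))) (x : Zd d) :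
    Tendsto (fun n => avg (f n) x) atTop (nhds (avg g x)) :=
  (tendsto_finsetSum _ fun _ _ => h _).const_mul _

/-- The sweeping identity for the capacity. -/
theorem capa_eq_sum_eqm_mul_hit (hd : d ≠ 0) (hP : IsSRW d P) {S X : Finset (Zd d)}
    (hSX : S ⊆ X) :
    capa P S = ∑ x ∈ X, eqm P (X : Set (Zd d)) x * (P x).real (hit (S : Set (Zd d))) := by
  have h1 : Tendsto (fun n => ∑ x ∈ X,
      (1 - avg (fun y => (P y).real (hitIn (box d n : Set (Zd d)) X)) x) *
        (P x).real (hitIn (box d n : Set (Zd d)) S)) atTop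
      (nhds (∑ x ∈ X, (1 - avg (fun y => (P y).real (hit (X : Set (Zd d)))) x) *
        (P x).real (hit (S : Set (Zd d))))) :=
    tendsto_finsetSum _ fun x _ => (tendsto_const_nhds.sub
      (tendsto_avg (fun y => tendsto_hitIn_box hP X y) x)).mul (tendsto_hitIn_box hP S x)
  have h2 : Tendsto (fun n => ∑ x ∈ S,
      (1 - avg (fun y => (P y).real (hitIn (box d n : Set (Zd d)) S)) x)) atTop
      (nhds (∑ x ∈ S, (1 - avg (fun y => (P y).real (hit (S : Set (Zd d)))) x))) :=
    tendsto_finsetSum _ fun x _ => tendsto_const_nhds.sub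
      (tendsto_avg (fun y => tendsto_hitIn_box hP S y) x)
  obtain ⟨N, hN⟩ := exists_subset_box X
  have h3 := tendsto_nhds_unique_of_eventuallyEq h1 h2
    (eventually_atTop.2 ⟨N, fun n hn =>
      sum_killed_eqm_mul hd hP hSX (hN.trans (box_mono hn))⟩)
  unfold capa
  rw [Finset.sum_congr rfl fun x hx => eqm_eq hd hP (Finset.mem_coe.2 hx), ← h3]
  exact Finset.sum_congr rfl fun x hx => by rw [eqm_eq hd hP (Finset.mem_coe.2 hx)]

lemma eqm_nonneg (V : Set (Zd d)) (x : Zd d) : 0 ≤ eqm P V x :=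
  Set.indicator_nonneg (fun _ _ => ENNReal.toReal_nonneg) x

lemma eqm_le_one (hP : IsSRW d P) (V : Set (Zd d)) (x : Zd d) : eqm P V x ≤ 1 := by
  have hprob := hP.1
  exact Set.indicator_le' (g := fun _ => (1 : ℝ)) (fun _ _ => measureReal_le_one)
    (fun _ _ => zero_le_one) x

end Sweeping

section Covering

variable {ι : Type*} [DecidableEq ι]

lemma eq_of_sum_powerset_eq {I : Finset ι} {f g : Finset ι → ℝ}
    (h : ∀ K ⊆ I, ∑ B ∈ K.powerset, f B = ∑ B ∈ K.powerset, g B) : ∀ K ⊆ I, f K = g K := by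
  intro K
  induction K using Finset.strongInduction with
  | H K ih =>
    intro hK
    have h1 := h K hK
    have hsplit : ∀ f : Finset ι → ℝ, ∑ B ∈ K.powerset, f B = f K + ∑ B ∈ K.ssubsets, f B := by
      intro f
      rw [Finset.ssubsets, Finset.add_sum_erase _ _ (Finset.mem_powerset_self K)]
    rw [hsplit f, hsplit g, Finset.sum_congr rfl fun B hB =>
      ih B (Finset.mem_ssubsets.1 hB) ((Finset.mem_ssubsets.1 hB).1.trans hK)] at h1
    exact add_right_cancel h1

/-- If a random subset of `I` has the avoidance probabilities of a union of a Poisson family of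
subsets with intensity `ν`, the probability that it is all of `I` obeys an exponential moment
bound. -/
theorem covering_le {I : Finset ι} {ν ρ : Finset ι → ℝ} (hν : ∀ A, 0 ≤ ν A)
    (hρ : ∀ K ⊆ I, ∑ B ∈ K.powerset, ρ B =
      Real.exp (-∑ A ∈ I.powerset with ¬A ⊆ K, ν A)) {z : ℝ} (hz : 1 ≤ z) :
    ρ I ≤ (z ^ I.card)⁻¹ * Real.exp (∑ A ∈ I.powerset, ν A * (z ^ A.card - 1)) := by
  classical
  set p : Finset ι → ℝ := fun A => 1 - Real.exp (-ν A) with hp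
  set q : Finset ι → ℝ := fun A => Real.exp (-ν A) with hq
  have hp0 : ∀ A, 0 ≤ p A := fun A => by
    simp only [hp, sub_nonneg, Real.exp_le_one_iff, neg_nonpos]; exact hν A
  have hq0 : ∀ A, 0 ≤ q A := fun A => (Real.exp_pos _).le
  set w : Finset (Finset ι) → ℝ := fun 𝒜 => (∏ A ∈ 𝒜, p A) * ∏ A ∈ I.powerset \ 𝒜, q A with hw
  have hw0 : ∀ 𝒜, 0 ≤ w 𝒜 := fun 𝒜 =>
    mul_nonneg (Finset.prod_nonneg fun A _ => hp0 A) (Finset.prod_nonneg fun A _ => hq0 A)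
  set r : Finset ι → ℝ := fun B => ∑ 𝒜 ∈ I.powerset.powerset with 𝒜.biUnion id = B, w 𝒜 with hr
  have hrsum : ∀ K ⊆ I, ∑ B ∈ K.powerset, r B =
      Real.exp (-∑ A ∈ I.powerset with ¬A ⊆ K, ν A) := by
    intro K hK
    have hsub : K.powerset ⊆ I.powerset := Finset.powerset_mono.2 hK
    have e1 : ∑ B ∈ K.powerset, r B = ∑ 𝒜 ∈ K.powerset.powerset, w 𝒜 := by
      have hfil : K.powerset.powerset =
          {𝒜 ∈ I.powerset.powerset | 𝒜.biUnion id ∈ K.powerset} := by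
        ext 𝒜
        simp only [Finset.mem_powerset, Finset.mem_filter, Finset.biUnion_subset, id]
        constructor
        · intro h
          exact ⟨h.trans hsub, fun A hA => Finset.mem_powerset.1 (h hA)⟩
        · rintro ⟨-, h⟩ A hA
          exact Finset.mem_powerset.2 (h A hA)
      rw [hfil, Finset.sum_filter, hr]
      simp only [Finset.sum_filter]
      rw [Finset.sum_comm]
      refine Finset.sum_congr rfl fun 𝒜 _ => ?_
      rw [Finset.sum_ite_eq]
    have e2 : ∀ 𝒜 ∈ K.powerset.powerset, w 𝒜 =
        ((∏ A ∈ 𝒜, p A) * ∏ A ∈ K.powerset \ 𝒜, q A) *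
          ∏ A ∈ I.powerset \ K.powerset, q A := by
      intro 𝒜 h𝒜
      rw [Finset.mem_powerset] at h𝒜
      change (∏ A ∈ 𝒜, p A) * ∏ A ∈ I.powerset \ 𝒜, q A = _
      rw [mul_assoc, ← Finset.prod_union]
      · congr 2
        ext A
        simp only [Finset.mem_sdiff, Finset.mem_union]
        constructor
        · rintro ⟨h1, h2⟩
          by_cases h3 : A ∈ K.powerset
          · exact Or.inl ⟨h3, h2⟩
          · exact Or.inr ⟨h1, h3⟩
        · rintro (⟨h1, h2⟩ | ⟨h1, h2⟩)
          · exact ⟨hsub h1, h2⟩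
          · exact ⟨h1, fun h => h2 (h𝒜 h)⟩
      · rw [Finset.disjoint_left]
        intro A h1 h2
        exact (Finset.mem_sdiff.1 h2).2 (Finset.mem_sdiff.1 h1).1
    rw [e1, Finset.sum_congr rfl e2, ← Finset.sum_mul, ← Finset.prod_add]
    have e3 : ∀ A ∈ K.powerset, p A + q A = 1 := fun A _ => by simp [hp, hq]
    rw [Finset.prod_congr rfl e3, Finset.prod_const_one, one_mul, hq, ← Real.exp_sum,
      Finset.sum_neg_distrib]
    congr 2
    refine Finset.sum_congr ?_ fun _ _ => rfl
    ext A
    simp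
  have hρr : ρ I = r I := eq_of_sum_powerset_eq (I := I)
    (fun K hK => (hρ K hK).trans (hrsum K hK).symm) I subset_rfl
  have hzpos : 0 < z := by linarith
  have hzp : 0 < z ^ I.card := by positivity
  rw [hρr, inv_mul_eq_div, le_div_iff₀ hzp]
  calc r I * z ^ I.card
      = ∑ 𝒜 ∈ I.powerset.powerset with 𝒜.biUnion id = I, w 𝒜 * z ^ I.card := by
        rw [hr, Finset.sum_mul]
    _ ≤ ∑ 𝒜 ∈ I.powerset.powerset with 𝒜.biUnion id = I, w 𝒜 * ∏ A ∈ 𝒜, z ^ A.card := by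
        refine Finset.sum_le_sum fun 𝒜 h𝒜 => mul_le_mul_of_nonneg_left ?_ (hw0 𝒜)
        rw [Finset.prod_pow_eq_pow_sum]
        refine pow_le_pow_right₀ hz ?_
        rw [← (Finset.mem_filter.1 h𝒜).2]
        exact Finset.card_biUnion_le
    _ ≤ ∑ 𝒜 ∈ I.powerset.powerset, w 𝒜 * ∏ A ∈ 𝒜, z ^ A.card :=
        Finset.sum_le_sum_of_subset_of_nonneg (Finset.filter_subset _ _) fun 𝒜 _ _ =>
          mul_nonneg (hw0 𝒜) (Finset.prod_nonneg fun A _ => by positivity)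
    _ = ∏ A ∈ I.powerset, (p A * z ^ A.card + q A) := by
        rw [Finset.prod_add]
        refine Finset.sum_congr rfl fun 𝒜 _ => ?_
        rw [Finset.prod_mul_distrib, hw]
        ring
    _ ≤ ∏ A ∈ I.powerset, Real.exp (ν A * (z ^ A.card - 1)) := by
        refine Finset.prod_le_prod (fun A _ => add_nonneg
          (mul_nonneg (hp0 A) (by positivity)) (hq0 A)) fun A _ => ?_
        have h1 : 1 ≤ z ^ A.card := one_le_pow₀ hz
        have h2 : p A ≤ ν A := by
          have := Real.add_one_le_exp (-ν A)
          simp only [hp]; linarith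
        have h3 := Real.add_one_le_exp (ν A * (z ^ A.card - 1))
        have h4 : q A = 1 - p A := by simp [hp, hq]
        rw [h4]
        nlinarith
    _ = _ := by rw [Real.exp_sum]

end Covering

section Selection

variable {ι Ω : Type*}

open Classical in
/-- The set of indices in `I` whose event occurs. -/
noncomputable def occurring (I : Finset ι) (E : ι → Set Ω) (ω : Ω) : Finset ι :=
  {i ∈ I | ω ∈ E i}

lemma mem_occurring {I : Finset ι} {E : ι → Set Ω} {ω : Ω} {i : ι} :
    i ∈ occurring I E ω ↔ i ∈ I ∧ ω ∈ E i := by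
  classical
  simp [occurring]

lemma occurring_subset (I : Finset ι) (E : ι → Set Ω) (ω : Ω) : occurring I E ω ⊆ I :=
  fun _ hi => (mem_occurring.1 hi).1

variable [MeasurableSpace Ω]

lemma measurableSet_occurring_eq {I : Finset ι} {E : ι → Set Ω} (hE : ∀ i, MeasurableSet (E i))
    (A : Finset ι) : MeasurableSet {ω | occurring I E ω = A} := by
  by_cases hA : A ⊆ I
  · have : {ω | occurring I E ω = A} = ⋂ i ∈ I, {ω | ω ∈ E i ↔ i ∈ A} := by
      ext ω
      simp only [Set.mem_ofPred_eq, Set.mem_iInter]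
      constructor
      · rintro rfl i hi
        rw [mem_occurring]
        tauto
      · intro h
        ext i
        rw [mem_occurring]
        constructor
        · rintro ⟨h1, h2⟩
          exact (h i h1).1 h2
        · intro h1
          exact ⟨hA h1, (h i (hA h1)).2 h1⟩
    rw [this]
    refine Finset.measurableSet_biInter _ fun i _ => ?_
    by_cases hi : i ∈ A
    · simpa [hi] using hE i
    · simp only [hi, iff_false]
      exact (hE i).compl
  · have : {ω | occurring I E ω = A} = ∅ := by
      ext ω
      simp only [Set.mem_ofPred_eq, Set.mem_empty_iff_false, iff_false]
      rintro rfl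
      exact hA (occurring_subset I E ω)
    rw [this]
    exact MeasurableSet.empty

lemma measurable_comp_occurring [Countable ι] {β : Type*} [MeasurableSpace β] (I : Finset ι)
    {E : ι → Set Ω} (hE : ∀ i, MeasurableSet (E i)) (g : Finset ι → β) :
    Measurable fun ω => g (occurring I E ω) := by
  let _ : MeasurableSpace (Finset ι) := ⊤
  have h : Measurable (occurring I E) :=
    measurable_to_countable' fun A => measurableSet_occurring_eq hE A
  exact measurable_from_top.comp h

lemma measureReal_occurring (μ : Measure Ω) [IsFiniteMeasure μ] {I : Finset ι} {E : ι → Set Ω}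
    (hE : ∀ i, MeasurableSet (E i)) (p : Finset ι → Prop) [DecidablePred p] :
    μ.real {ω | p (occurring I E ω)} =
      ∑ A ∈ I.powerset with p A, μ.real {ω | occurring I E ω = A} := by
  have : {ω | p (occurring I E ω)} =
      ⋃ A ∈ ({A ∈ I.powerset | p A} : Finset (Finset ι)), {ω | occurring I E ω = A} := by
    ext ω
    simp [occurring_subset]
  rw [this, measureReal_biUnion_finset]
  · intro A _ B _ hAB
    refine Set.disjoint_left.2 fun ω h1 h2 => hAB ?_
    exact (show occurring I E ω = A from h1).symm.trans h2
  · exact fun A _ => measurableSet_occurring_eq hE A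

end Selection

section Trace

variable {ι : Type*} {d : ℕ}

lemma ofReal_avg {f : Zd d → ℝ} (hd : d ≠ 0) (hf : ∀ x, 0 ≤ f x) (x : Zd d) :
    (2 * d : ENNReal)⁻¹ * ∑ s : Fin d × Bool, ENNReal.ofReal (f (x + step s)) =
      ENNReal.ofReal (avg f x) := by
  unfold avg
  have : (0 : ℝ) < 2 * d := by positivity
  rw [ENNReal.ofReal_mul (by positivity), ENNReal.ofReal_inv_of_pos this,
    ENNReal.ofReal_sum_of_nonneg fun _ _ => hf _, ENNReal.ofReal_mul (by norm_num)]
  simp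

/-- The event of hitting `V` before time `n`. -/
def hitBefore (n : ℕ) (V : Set (Zd d)) : Set (ℕ → Zd d) := {ω | ∃ k < n, ω k ∈ V}

lemma measurableSet_hitBefore (n : ℕ) (V : Set (Zd d)) : MeasurableSet (hitBefore n V) := by
  have : hitBefore n V = ⋃ k, ⋃ (_ : k < n), {ω : ℕ → Zd d | ω k ∈ V} := by
    ext ω; simp [hitBefore]
  rw [this]
  exact MeasurableSet.iUnion fun k => MeasurableSet.iUnion fun _ => measurableSet_eval_mem k V

/-- The indices of the sets hit before time `n`. -/
noncomputable def traceBefore (I : Finset ι) (F : ι → Set (Zd d)) (n : ℕ) :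
    (ℕ → Zd d) → Finset ι :=
  occurring I fun i => hitBefore n (F i)

/-- The indices of the sets containing `x`. -/
noncomputable def indexAt (I : Finset ι) (F : ι → Set (Zd d)) (x : Zd d) : Finset ι :=
  occurring I F x

/-- The indices of the sets hit by the path. -/
noncomputable def trace (I : Finset ι) (F : ι → Set (Zd d)) : (ℕ → Zd d) → Finset ι :=
  occurring I fun i => hit (F i)

lemma exists_traceBefore_eq (I : Finset ι) (F : ι → Set (Zd d)) (ω : ℕ → Zd d) :
    ∃ N, ∀ n, N ≤ n → traceBefore I F n ω = trace I F ω := by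
  have h : ∀ i, ∃ N, ∀ n, N ≤ n → (ω ∈ hitBefore n (F i) ↔ ω ∈ hit (F i)) := by
    intro i
    by_cases hω : ω ∈ hit (F i)
    · obtain ⟨k, hk⟩ := hω
      exact ⟨k + 1, fun n hn => ⟨fun ⟨k, _, hk⟩ => ⟨k, hk⟩, fun _ => ⟨k, hn, hk⟩⟩⟩
    · exact ⟨0, fun n _ => ⟨fun ⟨k, _, hk⟩ => ⟨k, hk⟩, fun h => absurd h hω⟩⟩
  choose N hN using h
  refine ⟨I.sup N, fun n hn => ?_⟩
  ext i
  simp only [traceBefore, trace, mem_occurring]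
  exact and_congr_right fun hi => hN i n ((Finset.le_sup hi).trans hn)

/-- Superharmonic barriers for a family of sets: `φ j` is superharmonic, at least one on the sets
with index different from `j`, and at most `q` on the set with index `j`. -/
structure IsBarrier (I : Finset ι) (F : ι → Set (Zd d)) (q : ℝ) (φ : ι → Zd d → ℝ) : Prop where
  nonneg : ∀ j x, 0 ≤ φ j x
  avg_le : ∀ j x, avg (φ j) x ≤ φ j x
  one_le : ∀ i ∈ I, ∀ j ∈ I, i ≠ j → ∀ x ∈ F i, 1 ≤ φ j x
  le : ∀ i ∈ I, ∀ x ∈ F i, φ i x ≤ q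

variable {I : Finset ι} {F : ι → Set (Zd d)} {q : ℝ} {φ : ι → Zd d → ℝ}

lemma avg_one_add_mul_le (hd : d ≠ 0) (hφ : IsBarrier I F q φ) {c : ℝ} (hc : 0 ≤ c) (j : ι)
    (x : Zd d) : avg (fun y => 1 + c * φ j y) x ≤ 1 + c * φ j x := by
  have h1 : avg (fun y => 1 + c * φ j y) x = 1 + c * avg (φ j) x := by
    have := avg_const hd 1 x
    unfold avg at *
    rw [Finset.sum_add_distrib, mul_add, this, ← Finset.mul_sum]
    ring
  rw [h1]
  have := mul_le_mul_of_nonneg_left (hφ.avg_le j x) hc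
  linarith

variable [DecidableEq ι]

lemma indexAt_eq (hF : ∀ i ∈ I, ∀ j ∈ I, i ≠ j → Disjoint (F i) (F j)) {i : ι} (hi : i ∈ I)
    {x : Zd d} (hx : x ∈ F i) : indexAt I F x = {i} := by
  ext j
  simp only [indexAt, mem_occurring, Finset.mem_singleton]
  constructor
  · rintro ⟨hj, h⟩
    by_contra hne
    exact Set.disjoint_left.1 (hF j hj i hi hne) h hx
  · rintro rfl
    exact ⟨hi, hx⟩

lemma traceBefore_consPath (I : Finset ι) (F : ι → Set (Zd d)) (n : ℕ) (x : Zd d)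
    (ω : ℕ → Zd d) :
    traceBefore I F (n + 1) (consPath x ω) = indexAt I F x ∪ traceBefore I F n ω := by
  ext i
  simp only [traceBefore, indexAt, mem_occurring, Finset.mem_union, hitBefore, Set.mem_ofPred_eq]
  constructor
  · rintro ⟨hi, k, hk, h⟩
    cases k with
    | zero => exact Or.inl ⟨hi, h⟩
    | succ k => exact Or.inr ⟨hi, k, by omega, h⟩
  · rintro (⟨hi, h⟩ | ⟨hi, k, hk, h⟩)
    · exact ⟨hi, 0, by omega, h⟩
    · exact ⟨hi, k + 1, by omega, h⟩

/-- The exponential moment of the number of sets outside `J` hit before time `n`. -/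
noncomputable def traceMoment (P : Zd d → Measure (ℕ → Zd d)) (I : Finset ι)
    (F : ι → Set (Zd d)) (z : ℝ) (n : ℕ) (J : Finset ι) (x : Zd d) : ENNReal :=
  ∫⁻ ω, ENNReal.ofReal (z ^ (traceBefore I F n ω \ J).card) ∂P x

variable {P : Zd d → Measure (ℕ → Zd d)} {z : ℝ}

lemma traceMoment_step_le (hd : d ≠ 0) (hφ : IsBarrier I F q φ) (hz : 1 ≤ z) {n : ℕ}
    {J : Finset ι} {j : ι}
    (h : ∀ x, traceMoment P I F z n J x ≤ ENNReal.ofReal (1 + 2 * z * φ j x)) (x : Zd d) :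
    (2 * d : ENNReal)⁻¹ * ∑ s : Fin d × Bool, traceMoment P I F z n J (x + step s) ≤
      ENNReal.ofReal (1 + 2 * z * φ j x) := by
  refine (mul_le_mul_right (Finset.sum_le_sum fun s _ => h (x + step s)) _).trans ?_
  rw [ofReal_avg (f := fun y => 1 + 2 * z * φ j y) hd]
  · exact ENNReal.ofReal_le_ofReal (avg_one_add_mul_le hd hφ (by linarith) j x)
  · intro y
    have := hφ.nonneg j y
    positivity

variable [Countable ι]

lemma traceMoment_succ (hd : d ≠ 0) (hP : IsSRW d P) (I : Finset ι) (F : ι → Set (Zd d))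
    (hz : 0 ≤ z) (n : ℕ) (J : Finset ι) (x : Zd d) :
    traceMoment P I F z (n + 1) J x = ENNReal.ofReal (z ^ (indexAt I F x \ J).card) *
      ((2 * d : ENNReal)⁻¹ * ∑ s : Fin d × Bool,
        traceMoment P I F z n (J ∪ indexAt I F x) (x + step s)) := by
  unfold traceMoment
  have hmeas : ∀ n (J : Finset ι), Measurable fun ω : ℕ → Zd d =>
      ENNReal.ofReal (z ^ (traceBefore I F n ω \ J).card) := fun n J =>
    measurable_comp_occurring I (fun i => measurableSet_hitBefore n (F i))
      fun A => ENNReal.ofReal (z ^ (A \ J).card)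
  rw [hP.lintegral_eq hd x (hmeas (n + 1) J), mul_left_comm]
  congr 1
  rw [Finset.mul_sum]
  refine Finset.sum_congr rfl fun s _ => ?_
  rw [← lintegral_const_mul _ (hmeas n _)]
  refine lintegral_congr fun ω => ?_
  rw [traceBefore_consPath, ← ENNReal.ofReal_mul (by positivity), ← pow_add,
    ← Finset.card_union_of_disjoint]
  · congr 3
    ext i
    simp only [Finset.mem_sdiff, Finset.mem_union]
    tauto
  · rw [Finset.disjoint_left]
    intro i
    simp only [Finset.mem_sdiff, Finset.mem_union]
    tauto

lemma traceMoment_le (hd : d ≠ 0) (hP : IsSRW d P) (hφ : IsBarrier I F q φ)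
    (hF : ∀ i ∈ I, ∀ j ∈ I, i ≠ j → Disjoint (F i) (F j)) (hz : 1 ≤ z) (hzq : 2 * z * q ≤ 1)
    (n : ℕ) : ∀ J, ∀ j ∈ J, j ∈ I → ∀ x,
      traceMoment P I F z n J x ≤ ENNReal.ofReal (1 + 2 * z * φ j x) := by
  have hprob := hP.1
  induction n with
  | zero =>
    intro J j _ _ x
    have h0 : ∀ ω, traceBefore I F 0 ω = ∅ := fun ω => by
      ext i; simp [traceBefore, mem_occurring, hitBefore]
    simp only [traceMoment, h0, Finset.empty_sdiff, Finset.card_empty, pow_zero,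
      ENNReal.ofReal_one, lintegral_const, measure_univ, mul_one]
    rw [← ENNReal.ofReal_one]
    refine ENNReal.ofReal_le_ofReal ?_
    have := mul_nonneg (show 0 ≤ 2 * z by linarith) (hφ.nonneg j x)
    linarith
  | succ n ih =>
    intro J j hjJ hjI x
    rw [traceMoment_succ hd hP I F (by linarith)]
    by_cases hsub : indexAt I F x ⊆ J
    · rw [Finset.sdiff_eq_empty_iff_subset.2 hsub, Finset.union_eq_left.2 hsub]
      simp only [Finset.card_empty, pow_zero, ENNReal.ofReal_one, one_mul]
      exact traceMoment_step_le hd hφ hz (ih J j hjJ hjI) x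
    · obtain ⟨i, hi, hiJ⟩ := Finset.not_subset.1 hsub
      obtain ⟨hiI, hx⟩ := mem_occurring.1 hi
      have hij : i ≠ j := fun h => hiJ (h ▸ hjJ)
      have h1 := traceMoment_step_le hd hφ hz (ih (J ∪ {i}) i (by simp) hiI) x
      rw [indexAt_eq hF hiI hx, Finset.sdiff_eq_self_of_disjoint (by simpa using hiJ),
        Finset.card_singleton, pow_one]
      refine (mul_le_mul_right h1 _).trans ?_
      rw [← ENNReal.ofReal_mul (by linarith)]
      refine ENNReal.ofReal_le_ofReal ?_
      have h2 := hφ.one_le i hiI j hjI hij x hx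
      have h3 := hφ.le i hiI x hx
      have h4 := mul_le_mul_of_nonneg_left h3 (show 0 ≤ 2 * z by linarith)
      have h5 : z * (1 + 2 * z * φ i x) ≤ z * 2 :=
        mul_le_mul_of_nonneg_left (by linarith) (by linarith)
      nlinarith

lemma traceMoment_empty_le (hd : d ≠ 0) (hP : IsSRW d P) (hφ : IsBarrier I F q φ)
    (hF : ∀ i ∈ I, ∀ j ∈ I, i ≠ j → Disjoint (F i) (F j)) (hz : 1 ≤ z) (hzq : 2 * z * q ≤ 1)
    (n : ℕ) {i : ι} (hi : i ∈ I) {x : Zd d} (hx : x ∈ F i) :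
    traceMoment P I F z (n + 1) ∅ x ≤ ENNReal.ofReal (2 * z) := by
  rw [traceMoment_succ hd hP I F (by linarith), indexAt_eq hF hi hx, Finset.sdiff_empty,
    Finset.card_singleton, pow_one, Finset.empty_union]
  refine (mul_le_mul_right (traceMoment_step_le hd hφ hz
    (traceMoment_le hd hP hφ hF hz hzq n {i} i (by simp) hi) x) _).trans ?_
  rw [← ENNReal.ofReal_mul (by linarith)]
  refine ENNReal.ofReal_le_ofReal ?_
  have h4 := mul_le_mul_of_nonneg_left (hφ.le i hi x hx) (show 0 ≤ 2 * z by linarith)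
  have h5 : z * (1 + 2 * z * φ i x) ≤ z * 2 :=
    mul_le_mul_of_nonneg_left (by linarith) (by linarith)
  linarith

lemma sum_trace_moment_le (hd : d ≠ 0) (hP : IsSRW d P) (hφ : IsBarrier I F q φ)
    (hF : ∀ i ∈ I, ∀ j ∈ I, i ≠ j → Disjoint (F i) (F j)) (hz : 1 ≤ z) (hzq : 2 * z * q ≤ 1)
    {i : ι} (hi : i ∈ I) {x : Zd d} (hx : x ∈ F i) :
    ∑ A ∈ I.powerset, (P x).real {ω | trace I F ω = A} * z ^ A.card ≤ 2 * z := by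
  have hprob := hP.1
  have hz0 : 0 ≤ z := by linarith
  have hmeas : ∀ A, MeasurableSet {ω : ℕ → Zd d | trace I F ω = A} := fun A =>
    measurableSet_occurring_eq (fun i => measurableSet_hit (F i)) A
  have h1 : ∫⁻ ω, ENNReal.ofReal (z ^ (trace I F ω).card) ∂P x ≤ ENNReal.ofReal (2 * z) := by
    have hlim : ∀ ω, ENNReal.ofReal (z ^ (trace I F ω).card) =
        liminf (fun n => ENNReal.ofReal (z ^ (traceBefore I F (n + 1) ω).card)) atTop := by
      intro ω
      obtain ⟨N, hN⟩ := exists_traceBefore_eq I F ω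
      refine (Tendsto.liminf_eq ?_).symm
      refine tendsto_const_nhds.congr' (eventually_atTop.2 ⟨N, fun n hn => ?_⟩)
      exact congrArg (fun A : Finset ι => ENNReal.ofReal (z ^ A.card)) (hN (n + 1) (by omega)).symm
    rw [lintegral_congr hlim]
    refine (lintegral_liminf_le fun n => measurable_comp_occurring I
      (fun i => measurableSet_hitBefore (n + 1) (F i))
      fun A => ENNReal.ofReal (z ^ A.card)).trans ?_
    refine liminf_le_of_le (by isBoundedDefault) fun b hb => ?_
    obtain ⟨n, hn⟩ := hb.exists
    refine hn.trans ?_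
    have := traceMoment_empty_le hd hP hφ hF hz hzq n hi hx
    simpa only [traceMoment, Finset.sdiff_empty] using! this
  have h2 : ∫⁻ ω, ENNReal.ofReal (z ^ (trace I F ω).card) ∂P x =
      ∑ A ∈ I.powerset, ENNReal.ofReal (z ^ A.card) * P x {ω | trace I F ω = A} := by
    have : ∀ ω, ENNReal.ofReal (z ^ (trace I F ω).card) = ∑ A ∈ I.powerset,
        Set.indicator {ω | trace I F ω = A} (fun _ => ENNReal.ofReal (z ^ A.card)) ω := by
      intro ω
      rw [Finset.sum_eq_single (trace I F ω)]
      · simp [Set.indicator]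
      · intro A _ hA
        simp [Set.indicator, hA.symm]
      · intro h
        exact absurd (Finset.mem_powerset.2 (occurring_subset I _ ω)) h
    rw [lintegral_congr this, lintegral_finsetSum _
      fun A _ => measurable_const.indicator (hmeas A)]
    exact Finset.sum_congr rfl fun A _ => lintegral_indicator_const (hmeas A) _
  rw [h2] at h1
  have h3 : ENNReal.ofReal (∑ A ∈ I.powerset, (P x).real {ω | trace I F ω = A} * z ^ A.card) ≤
      ENNReal.ofReal (2 * z) := by
    rw [ENNReal.ofReal_sum_of_nonneg fun A _ => by positivity]
    refine (Finset.sum_le_sum fun A _ => ?_).trans h1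
    rw [ENNReal.ofReal_mul (by positivity), mul_comm, ofReal_measureReal]
  exact (ENNReal.ofReal_le_ofReal_iff (by linarith)).1 h3

end Trace

section Occupation

variable {ι : Type*} [DecidableEq ι] {d : ℕ} {P : Zd d → Measure (ℕ → Zd d)}

/-- The event that some point of `V` is occupied. -/
def occupied (V : Set (Zd d)) : Set (Zd d → Bool) := {Y | ∃ x ∈ V, Y x = false}

lemma measurableSet_occupied (V : Set (Zd d)) : MeasurableSet (occupied V) := by
  have : occupied V = ⋃ x ∈ V, (fun Y : Zd d → Bool => Y x) ⁻¹' {false} := by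
    ext Y; simp [occupied]
  rw [this]
  exact MeasurableSet.biUnion V.to_countable fun x _ =>
    measurable_pi_apply x (MeasurableSet.singleton _)

/-- The intensity of the walks with trace `A` on the family `F`. -/
noncomputable def traceIntensity (P : Zd d → Measure (ℕ → Zd d)) (I : Finset ι)
    (F : ι → Finset (Zd d)) (A : Finset ι) : ℝ :=
  ∑ x ∈ I.biUnion F, eqm P (I.biUnion F : Set (Zd d)) x *
    (P x).real {ω | trace I (fun i => (F i : Set (Zd d))) ω = A}

lemma capa_eq_sum_traceIntensity (hd : d ≠ 0) (hP : IsSRW d P) {I K : Finset ι}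
    (F : ι → Finset (Zd d)) :
    capa P ((I \ K).biUnion F) = ∑ A ∈ I.powerset with ¬A ⊆ K, traceIntensity P I F A := by
  have hprob := hP.1
  rw [capa_eq_sum_eqm_mul_hit hd hP
    (Finset.biUnion_subset_biUnion_of_subset_left F (Finset.sdiff_subset : I \ K ⊆ I))]
  unfold traceIntensity
  rw [Finset.sum_comm]
  refine Finset.sum_congr rfl fun x _ => ?_
  rw [← Finset.mul_sum]
  congr 1
  have hset : hit (((I \ K).biUnion F : Finset (Zd d)) : Set (Zd d)) =
      {ω | ¬trace I (fun i => (F i : Set (Zd d))) ω ⊆ K} := by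
    ext ω
    simp only [hit, trace, Set.mem_ofPred_eq, Finset.not_subset, mem_occurring, Finset.mem_coe,
      Finset.mem_biUnion, Finset.mem_sdiff]
    constructor
    · rintro ⟨n, i, ⟨h1, h2⟩, h3⟩
      exact ⟨i, ⟨h1, n, h3⟩, h2⟩
    · rintro ⟨i, ⟨h1, n, h3⟩, h2⟩
      exact ⟨n, i, ⟨h1, h2⟩, h3⟩
  rw [hset]
  exact measureReal_occurring (P x) (I := I) (fun i => measurableSet_hit (F i : Set (Zd d)))
    (fun A => ¬A ⊆ K)

variable {u : ℝ} {Q : Measure (Zd d → Bool)}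

/-- The probability that every set of a family with small barriers meets the occupied set. -/
theorem IsVacantLaw.all_occupied_le [Countable ι] (hd : d ≠ 0) (hP : IsSRW d P) (hQ : IsVacantLaw P u Q)
    (hu : 0 ≤ u) {I : Finset ι} {F : ι → Finset (Zd d)} {q z : ℝ} {φ : ι → Zd d → ℝ}
    (hφ : IsBarrier I (fun i => (F i : Set (Zd d))) q φ)
    (hF : ∀ i ∈ I, ∀ j ∈ I, i ≠ j → Disjoint (F i : Set (Zd d)) (F j))
    (hz : 1 ≤ z) (hzq : 2 * z * q ≤ 1) {N : ℕ} (hN : ∀ i, (F i).card ≤ N) :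
    Q.real {Y | ∀ i ∈ I, Y ∈ occupied (F i : Set (Zd d))} ≤
      (z⁻¹ * Real.exp (u * (2 * z) * N)) ^ I.card := by
  have hprob := hP.1
  obtain ⟨hQp, hQ⟩ := hQ
  set E : ι → Set (Zd d → Bool) := fun i => occupied (F i : Set (Zd d)) with hE
  have hEm : ∀ i, MeasurableSet (E i) := fun i => measurableSet_occupied _
  have hz0 : 0 ≤ z := by linarith
  have hν : ∀ A, 0 ≤ traceIntensity P I F A := fun A =>
    Finset.sum_nonneg fun x _ => mul_nonneg (eqm_nonneg _ _) measureReal_nonneg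
  have hρ : ∀ K ⊆ I, ∑ B ∈ K.powerset, Q.real {Y | occurring I E Y = B} =
      Real.exp (-∑ A ∈ I.powerset with ¬A ⊆ K, u * traceIntensity P I F A) := by
    intro K hK
    rw [← Finset.mul_sum, ← capa_eq_sum_traceIntensity hd hP]
    have h1 := measureReal_occurring Q (I := I) hEm (fun A => A ⊆ K)
    have h2 : ({A ∈ I.powerset | A ⊆ K} : Finset (Finset ι)) = K.powerset := by
      ext A
      simp only [Finset.mem_filter, Finset.mem_powerset]
      exact ⟨fun h => h.2, fun h => ⟨h.trans hK, h⟩⟩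
    rw [h2] at h1
    rw [← h1]
    have h3 : {Y | occurring I E Y ⊆ K} = {Y | ∀ x ∈ (I \ K).biUnion F, Y x = true} := by
      ext Y
      simp only [Set.mem_ofPred_eq, Finset.subset_iff, mem_occurring, hE, occupied,
        Finset.mem_biUnion, Finset.mem_sdiff, Finset.mem_coe]
      constructor
      · rintro h x ⟨i, ⟨hi, hiK⟩, hx⟩
        by_contra hY
        exact hiK (h ⟨hi, x, hx, by simpa using hY⟩)
      · rintro h i ⟨hi, x, hx, hY⟩
        by_contra hiK
        simp [h x ⟨i, ⟨hi, hiK⟩, hx⟩] at hY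
    rw [h3, Measure.real, hQ, ENNReal.toReal_ofReal (Real.exp_pos _).le]
  have hcov := covering_le (I := I) (ν := fun A => u * traceIntensity P I F A)
    (fun A => mul_nonneg hu (hν A)) hρ hz
  have hall : {Y | ∀ i ∈ I, Y ∈ occupied (F i : Set (Zd d))} = {Y | occurring I E Y = I} := by
    ext Y
    simp only [Set.mem_ofPred_eq]
    constructor
    · intro h
      ext i
      rw [mem_occurring]
      exact ⟨fun h' => h'.1, fun h' => ⟨h', h i h'⟩⟩
    · intro h i hi
      rw [← h, mem_occurring] at hi
      exact hi.2
  rw [hall]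
  refine hcov.trans ?_
  rw [mul_pow, ← inv_pow, ← Real.exp_nat_mul]
  refine mul_le_mul_of_nonneg_left (Real.exp_le_exp.2 ?_) (by positivity)
  calc ∑ A ∈ I.powerset, u * traceIntensity P I F A * (z ^ A.card - 1)
      ≤ ∑ A ∈ I.powerset, u * traceIntensity P I F A * z ^ A.card :=
        Finset.sum_le_sum fun A _ => mul_le_mul_of_nonneg_left (by linarith)
          (mul_nonneg hu (hν A))
    _ = u * ∑ x ∈ I.biUnion F, eqm P (I.biUnion F : Set (Zd d)) x *
          ∑ A ∈ I.powerset,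
            (P x).real {ω | trace I (fun i => (F i : Set (Zd d))) ω = A} * z ^ A.card := by
        simp only [traceIntensity, Finset.mul_sum, Finset.sum_mul]
        rw [Finset.sum_comm]
        refine Finset.sum_congr rfl fun x _ => Finset.sum_congr rfl fun A _ => ?_
        ring
    _ ≤ u * ∑ x ∈ I.biUnion F, 2 * z := by
        refine mul_le_mul_of_nonneg_left (Finset.sum_le_sum fun x hx => ?_) hu
        obtain ⟨i, hi, hx⟩ := Finset.mem_biUnion.1 hx
        have h1 := sum_trace_moment_le hd hP hφ hF hz hzq hi (x := x) (by exact_mod_cast hx)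
        calc _ ≤ eqm P (I.biUnion F : Set (Zd d)) x * (2 * z) :=
              mul_le_mul_of_nonneg_left h1 (eqm_nonneg _ _)
          _ ≤ 1 * (2 * z) := mul_le_mul_of_nonneg_right (eqm_le_one hP _ _) (by linarith)
          _ = 2 * z := one_mul _
    _ ≤ u * ((I.card * N : ℕ) * (2 * z)) := by
        rw [Finset.sum_const, nsmul_eq_mul]
        refine mul_le_mul_of_nonneg_left (mul_le_mul_of_nonneg_right ?_ (by linarith)) hu
        exact_mod_cast Finset.card_biUnion_le_card_mul I F N fun i _ => hN i
    _ = I.card * (u * (2 * z) * N) := by push_cast; ring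

end Occupation

section Superharmonic

variable {d : ℕ}

lemma inv_sqrt_one_add_le {t : ℝ} (ht : |t| ≤ 1 / 4) :
    (√(1 + t))⁻¹ ≤ 1 - t / 2 + 3 * t ^ 2 / 8 - 5 * t ^ 3 / 16 + t ^ 4 / 2 := by
  obtain ⟨h1, h2⟩ := abs_le.1 ht
  set p := 1 - t / 2 + 3 * t ^ 2 / 8 - 5 * t ^ 3 / 16 + t ^ 4 / 2 with hp
  have hc : t ^ 3 ≤ 1 / 4 * t ^ 2 := by nlinarith [sq_nonneg t]
  have hp0 : 0 < p := by
    rw [hp]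
    nlinarith [sq_nonneg t, sq_nonneg (t ^ 2)]
  have hpos : 0 < 1 + t := by linarith
  rw [inv_le_comm₀ (by positivity) hp0]
  refine Real.le_sqrt_of_sq_le ?_
  rw [inv_pow, inv_le_comm₀ (by positivity) hpos, ← one_div, div_le_iff₀ hpos]
  have key : p ^ 2 * (1 + t) = 1 + t ^ 4 * (29 / 64 + 23 / 32 * t - 67 / 256 * t ^ 2
      + 41 / 256 * t ^ 3 - 1 / 16 * t ^ 4 + 1 / 4 * t ^ 5) := by
    rw [hp]; ring
  have ht2 : t ^ 2 ≤ 1 / 16 := by nlinarith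
  have h3 : -(1 / 64) ≤ t ^ 3 := by nlinarith
  have h4 : t ^ 4 ≤ 1 / 256 := by nlinarith
  have h5 : -(1 / 1024) ≤ t ^ 5 := by nlinarith [sq_nonneg (t ^ 2)]
  rw [key]
  have : 0 ≤ t ^ 4 := by positivity
  nlinarith

/-- The squared Euclidean norm of a lattice point. -/
def normSq (x : Zd d) : ℝ := ∑ i, (x i : ℝ) ^ 2

lemma normSq_nonneg (x : Zd d) : 0 ≤ normSq x := Finset.sum_nonneg fun _ _ => sq_nonneg _

/-- A superharmonic function with the decay of the Newtonian potential of a line. -/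
noncomputable def potential (x : Zd d) : ℝ := (√(normSq x + 15))⁻¹

lemma potential_nonneg (x : Zd d) : 0 ≤ potential x := by unfold potential; positivity

lemma normSq_add_step (x : Zd d) (i : Fin d) (b : Bool) :
    normSq (x + step (i, b)) = normSq x + 1 + (if b then 2 * (x i : ℝ) else -(2 * (x i : ℝ))) := by
  have h : ∀ j, ((x + step (i, b)) j : ℝ) ^ 2 = (x j : ℝ) ^ 2 +
      if j = i then 1 + (if b then 2 * (x i : ℝ) else -(2 * (x i : ℝ))) else 0 := by
    intro j
    by_cases hj : j = i
    · subst hj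
      cases b <;> simp [step] <;> ring
    · simp [step, hj]
  unfold normSq
  rw [Finset.sum_congr rfl fun j _ => h j, Finset.sum_add_distrib, Finset.sum_ite_eq']
  simp [add_assoc]

lemma inv_sqrt_add_add_inv_sqrt_sub_le {w y : ℝ} (hw : y ^ 2 + 16 ≤ w) :
    (√(w + 2 * y))⁻¹ + (√(w - 2 * y))⁻¹ ≤
      (√w)⁻¹ * (2 + y ^ 2 * (3 / w ^ 2 + 16 / w ^ 3)) := by
  have hw0 : 0 < w := by nlinarith [sq_nonneg y]
  have ht : |2 * y / w| ≤ 1 / 4 := by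
    rw [abs_div, abs_of_pos hw0, div_le_iff₀ hw0, abs_mul, abs_two]
    nlinarith [sq_abs y, sq_nonneg (|y| - 4)]
  have h1 := inv_sqrt_one_add_le ht
  have h2 := inv_sqrt_one_add_le (t := -(2 * y / w)) (by rwa [abs_neg])
  have e1 : w + 2 * y = w * (1 + 2 * y / w) := by field_simp
  have e2 : w - 2 * y = w * (1 + -(2 * y / w)) := by field_simp; ring
  rw [e1, e2, Real.sqrt_mul hw0.le, Real.sqrt_mul hw0.le, mul_inv, mul_inv, ← mul_add]
  refine mul_le_mul_of_nonneg_left ?_ (by positivity)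
  have h3 : (2 * y / w) ^ 4 ≤ y ^ 2 * (16 / w ^ 3) := by
    rw [div_pow, mul_div_assoc', div_le_div_iff₀ (by positivity) (by positivity)]
    have : y ^ 2 ≤ w := by linarith
    have h4 : 0 ≤ y ^ 2 * w ^ 3 := by positivity
    nlinarith [mul_le_mul_of_nonneg_left this h4]
  have h5 : (2 * y / w) ^ 2 * 3 / 4 = y ^ 2 * (3 / w ^ 2) := by ring
  have h6 : (-(2 * y / w)) ^ 3 = -(2 * y / w) ^ 3 := by ring
  have h7 : (-(2 * y / w)) ^ 2 = (2 * y / w) ^ 2 := by ring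
  have h8 : (-(2 * y / w)) ^ 4 = (2 * y / w) ^ 4 := by ring
  rw [h6, h7, h8] at h2
  rw [mul_add (y ^ 2)]
  linarith

lemma avg_potential_le (hd : 3 ≤ d) (x : Zd d) : avg potential x ≤ potential x := by
  have hn := normSq_nonneg x
  set w := normSq x + 16 with hw
  have hw0 : 0 < w := by linarith
  have h1 : ∑ s : Fin d × Bool, potential (x + step s) ≤ (√w)⁻¹ * (2 * d + 3 / w) := by
    rw [Fintype.sum_prod_type]
    calc ∑ i : Fin d, ∑ b : Bool, potential (x + step (i, b))
        ≤ ∑ i : Fin d, (√w)⁻¹ * (2 + (x i : ℝ) ^ 2 * (3 / w ^ 2 + 16 / w ^ 3)) := by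
          refine Finset.sum_le_sum fun i _ => ?_
          rw [Fintype.sum_bool]
          have hi : (x i : ℝ) ^ 2 ≤ normSq x :=
            Finset.single_le_sum (f := fun i => (x i : ℝ) ^ 2) (fun _ _ => sq_nonneg _)
              (Finset.mem_univ i)
          have := inv_sqrt_add_add_inv_sqrt_sub_le (w := w) (y := x i) (by linarith)
          have e1 : normSq (x + step (i, true)) + 15 = w + 2 * x i := by
            rw [normSq_add_step, if_pos rfl, hw]; ring
          have e2 : normSq (x + step (i, false)) + 15 = w - 2 * x i := by
            rw [normSq_add_step, if_neg Bool.false_ne_true, hw]; ring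
          rwa [potential, potential, e1, e2]
      _ = (√w)⁻¹ * (2 * d + normSq x * (3 / w ^ 2 + 16 / w ^ 3)) := by
          rw [← Finset.mul_sum, Finset.sum_add_distrib, ← Finset.sum_mul]
          simp [normSq, mul_comm]
      _ ≤ _ := by
          refine mul_le_mul_of_nonneg_left (add_le_add_right ?_ _) (by positivity)
          have : normSq x = w - 16 := by rw [hw]; ring
          rw [this]
          have e : (w - 16) * (3 / w ^ 2 + 16 / w ^ 3) = 3 / w - (32 * w + 256) / w ^ 3 := by
            field_simp; ring
          rw [e]
          have : 0 ≤ (32 * w + 256) / w ^ 3 := by positivity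
          linarith
  have hd' : (3 : ℝ) ≤ d := by exact_mod_cast hd
  have h2 : (√w)⁻¹ * (1 + 1 / (2 * w)) ≤ potential x := by
    have e : normSq x + 15 = w - 1 := by rw [hw]; ring
    unfold potential
    have hw1 : 0 < w - 1 := by linarith
    rw [e, ← one_div, ← one_div, one_div_mul_eq_div, div_le_div_iff₀ (by positivity) (by positivity),
      one_mul]
    refine Real.le_sqrt_of_sq_le ?_
    rw [mul_pow, Real.sq_sqrt hw1.le]
    have e2 : (1 + 1 / (2 * w)) ^ 2 * (w - 1) = w - (3 / 4) * w⁻¹ - (1 / 4) * (w⁻¹) ^ 2 := by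
      field_simp; ring
    have : 0 < w⁻¹ := by positivity
    rw [e2]
    nlinarith
  refine le_trans ?_ h2
  unfold avg
  rw [inv_mul_le_iff₀ (by positivity)]
  refine h1.trans ?_
  rw [← mul_assoc, mul_comm (2 * (d : ℝ)), mul_assoc]
  refine mul_le_mul_of_nonneg_left ?_ (by positivity)
  rw [mul_add, mul_one]
  have : 3 / w ≤ 2 * d * (1 / (2 * w)) := by
    rw [mul_one_div, mul_div_mul_left _ _ two_ne_zero]
    gcongr
  linarith

lemma avg_potential_sub_le (hd : 3 ≤ d) (y x : Zd d) :
    avg (fun x => potential (x - y)) x ≤ potential (x - y) := by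
  have := avg_potential_le hd (x - y)
  unfold avg at *
  simpa only [add_sub_right_comm] using this

end Superharmonic

section Frames

variable {d : ℕ}

/-- The embedding of the plane `ℤ²` into `ℤ^d`. -/
def emb (d : ℕ) (p : ℤ × ℤ) : Zd d :=
  fun i => if (i : ℕ) = 0 then p.1 else if (i : ℕ) = 1 then p.2 else 0

lemma emb_sub (p q : ℤ × ℤ) : emb d p - emb d q = emb d (p - q) := by
  ext i
  simp only [emb, Pi.sub_apply]
  split_ifs <;> simp

lemma emb_injective (hd : 2 ≤ d) : Function.Injective (emb d) := by
  intro p q h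
  have h0 := congrFun h ⟨0, by omega⟩
  have h1 := congrFun h ⟨1, by omega⟩
  simp only [emb] at h0 h1
  exact Prod.ext (by simpa using h0) (by simpa using h1)

lemma inPlane_emb (p : ℤ × ℤ) : inPlane (emb d p) := by
  intro i hi
  simp only [emb]
  rw [if_neg (by omega), if_neg (by omega)]

lemma sum_emb (hd : 2 ≤ d) {M : Type*} [AddCommMonoid M] (g : ℤ → M) (h0 : g 0 = 0) (p : ℤ × ℤ) :
    ∑ i, g (emb d p i) = g p.1 + g p.2 := by
  obtain ⟨n, rfl⟩ : ∃ n, d = n + 2 := ⟨d - 2, by omega⟩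
  rw [Fin.sum_univ_succ, Fin.sum_univ_succ, Finset.sum_eq_zero, add_zero]
  · simp [emb]
  · intro i _
    simp [emb, h0]

lemma adj_emb (hd : 2 ≤ d) (p q : ℤ × ℤ) :
    adj (emb d p) (emb d q) ↔ |p.1 - q.1| + |p.2 - q.2| = 1 := by
  have := sum_emb hd (fun a : ℤ => |a|) abs_zero (p - q)
  rw [← emb_sub] at this
  unfold adj
  simp only [Pi.sub_apply, Prod.fst_sub, Prod.snd_sub] at this
  rw [this]

lemma potential_emb (hd : 2 ≤ d) (p : ℤ × ℤ) :
    potential (emb d p) = (√((p.1 : ℝ) ^ 2 + (p.2 : ℝ) ^ 2 + 15))⁻¹ := by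
  unfold potential normSq
  rw [sum_emb hd (fun a : ℤ => (a : ℝ) ^ 2) (by simp)]

lemma potential_emb_le (hd : 2 ≤ d) {p : ℤ × ℤ} {m : ℝ} (hm : 0 < m)
    (h : m ≤ |(p.1 : ℝ)| ∨ m ≤ |(p.2 : ℝ)|) : potential (emb d p) ≤ m⁻¹ := by
  rw [potential_emb hd]
  refine inv_anti₀ hm (Real.le_sqrt_of_sq_le ?_)
  rcases h with h | h
  · nlinarith [sq_abs (p.1 : ℝ), sq_nonneg (p.2 : ℝ)]
  · nlinarith [sq_abs (p.2 : ℝ), sq_nonneg (p.1 : ℝ)]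

lemma le_potential_emb (hd : 2 ≤ d) {p : ℤ × ℤ} {m : ℕ}
    (h : (p.1 : ℝ) ^ 2 + (p.2 : ℝ) ^ 2 ≤ (m : ℝ) ^ 2) :
    ((m : ℝ) + 4)⁻¹ ≤ potential (emb d p) := by
  rw [potential_emb hd]
  refine inv_anti₀ (by positivity) (Real.sqrt_le_iff.2 ⟨by positivity, ?_⟩)
  have : (0 : ℝ) ≤ m := m.cast_nonneg
  nlinarith

/-- The boundary of the square `[L a, L a + L] × [L b, L b + L]`, for `i = (a, b)`. -/
noncomputable def frame (L : ℕ) (i : ℤ × ℤ) : Finset (ℤ × ℤ) :=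
  ({L * i.1, L * i.1 + L} : Finset ℤ) ×ˢ Finset.Icc (L * i.2) (L * i.2 + L) ∪
    Finset.Icc (L * i.1) (L * i.1 + L) ×ˢ ({L * i.2, L * i.2 + L} : Finset ℤ)

lemma mem_frame {L : ℕ} {i p : ℤ × ℤ} : p ∈ frame L i ↔
    ((p.1 = L * i.1 ∨ p.1 = L * i.1 + L) ∧ L * i.2 ≤ p.2 ∧ p.2 ≤ L * i.2 + L) ∨
      ((L * i.1 ≤ p.1 ∧ p.1 ≤ L * i.1 + L) ∧ (p.2 = L * i.2 ∨ p.2 = L * i.2 + L)) := by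
  simp [frame]

lemma card_frame_le (L : ℕ) (i : ℤ × ℤ) : (frame L i).card ≤ 4 * (L + 1) := by
  refine (Finset.card_union_le _ _).trans ?_
  rw [Finset.card_product, Finset.card_product, Int.card_Icc, Int.card_Icc]
  have h1 : ∀ a b : ℤ, ({a, b} : Finset ℤ).card ≤ 2 := fun a b => Finset.card_le_two
  have h2 : ∀ a : ℤ, (a + L + 1 - a).toNat = L + 1 := fun a => by omega
  rw [h2, h2]
  nlinarith [h1 (L * i.1) (L * i.1 + L), h1 (L * i.2) (L * i.2 + L)]

/-- The separation of two frames, in units of their side. -/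
def sep (i j : ℤ × ℤ) : ℤ := max |i.1 - j.1| |i.2 - j.2| - 1

lemma sep_comm (i j : ℤ × ℤ) : sep i j = sep j i := by
  simp only [sep, abs_sub_comm]

lemma le_abs_sub_of_mem_frame {L : ℕ} {i j p q : ℤ × ℤ} (hp : p ∈ frame L i) (hq : q ∈ frame L j) :
    L * sep i j ≤ |p.1 - q.1| ∨ L * sep i j ≤ |p.2 - q.2| := by
  have aux : ∀ a b x y : ℤ, L * a ≤ x → x ≤ L * a + L → L * b ≤ y → y ≤ L * b + L →
      L * (|a - b| - 1) ≤ |x - y| := by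
    intro a b x y h1 h2 h3 h4
    rcases abs_cases (a - b) with ⟨h, _⟩ | ⟨h, _⟩ <;> rw [h]
    · exact le_trans (by linarith) (le_abs_self _)
    · exact le_trans (by linarith) (neg_le_abs _)
  have hL : (0 : ℤ) ≤ L := by positivity
  rw [mem_frame] at hp hq
  rcases max_cases |i.1 - j.1| |i.2 - j.2| with ⟨h, _⟩ | ⟨h, _⟩ <;> unfold sep <;> rw [h]
  · left; apply aux <;> omega
  · right; apply aux <;> omega

/-- From each point of a frame, a long lattice segment stays in the frame. -/
lemma exists_segment_subset_frame {M : ℕ} {i p : ℤ × ℤ} (hp : p ∈ frame (2 * M) i) :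
    ∃ v : ℤ × ℤ, v.1 ^ 2 + v.2 ^ 2 = 1 ∧ ∀ m : ℕ, m ≤ M →
      (p.1 - m * v.1, p.2 - m * v.2) ∈ frame (2 * M) i := by
  simp only [mem_frame] at hp ⊢
  push_cast at *
  rcases hp with ⟨h1, h2⟩ | ⟨h1, h2⟩
  · by_cases h : 2 * (M : ℤ) * i.2 + M ≤ p.2
    · refine ⟨(0, 1), by norm_num, fun m hm => Or.inl ?_⟩
      simp only; omega
    · refine ⟨(0, -1), by norm_num, fun m hm => Or.inl ?_⟩
      simp only; omega
  · by_cases h : 2 * (M : ℤ) * i.1 + M ≤ p.1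
    · refine ⟨(1, 0), by norm_num, fun m hm => Or.inr ?_⟩
      simp only; omega
    · refine ⟨(-1, 0), by norm_num, fun m hm => Or.inr ?_⟩
      simp only; omega

/-- The potential of a frame. -/
noncomputable def framePotential (L : ℕ) (i : ℤ × ℤ) (x : Zd d) : ℝ :=
  ∑ p ∈ frame L i, potential (x - emb d p)

lemma framePotential_nonneg (L : ℕ) (i : ℤ × ℤ) (x : Zd d) : 0 ≤ framePotential L i x :=
  Finset.sum_nonneg fun _ _ => potential_nonneg _

lemma le_framePotential (hd : 2 ≤ d) {M : ℕ} {i p : ℤ × ℤ} (hp : p ∈ frame (2 * M) i) :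
    ∑ m ∈ Finset.range M, ((m : ℝ) + 4)⁻¹ ≤ framePotential (2 * M) i (emb d p) := by
  obtain ⟨v, hv, hseg⟩ := exists_segment_subset_frame hp
  set g : ℕ → ℤ × ℤ := fun m => (p.1 - m * v.1, p.2 - m * v.2) with hg
  have hinj : Set.InjOn g (Finset.range M : Set ℕ) := by
    intro m _ n _ h
    simp only [hg, Prod.mk.injEq] at h
    have h1 : ((m : ℤ) - n) * v.1 = 0 := by linarith [h.1]
    have h2 : ((m : ℤ) - n) * v.2 = 0 := by linarith [h.2]
    have : ((m : ℤ) - n) = 0 := by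
      calc ((m : ℤ) - n) = (m - n) * v.1 * v.1 + (m - n) * v.2 * v.2 := by
            rw [mul_assoc, mul_assoc, ← mul_add, ← sq, ← sq, hv, mul_one]
        _ = 0 := by rw [h1, h2]; ring
    omega
  calc ∑ m ∈ Finset.range M, ((m : ℝ) + 4)⁻¹
      ≤ ∑ m ∈ Finset.range M, potential (emb d p - emb d (g m)) := by
        refine Finset.sum_le_sum fun m _ => ?_
        rw [emb_sub]
        refine le_potential_emb hd (le_of_eq ?_)
        have hv' : (v.1 : ℝ) ^ 2 + (v.2 : ℝ) ^ 2 = 1 := by exact_mod_cast hv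
        simp only [hg, Prod.fst_sub, Prod.snd_sub, sub_sub_cancel]
        push_cast
        rw [mul_pow, mul_pow, ← mul_add, hv', mul_one]
    _ = ∑ y ∈ (Finset.range M).image g, potential (emb d p - emb d y) :=
        (Finset.sum_image (f := fun y => potential (emb d p - emb d y)) hinj).symm
    _ ≤ _ := by
        refine Finset.sum_le_sum_of_subset_of_nonneg ?_ fun _ _ _ => potential_nonneg _
        intro y hy
        obtain ⟨m, hm, rfl⟩ := Finset.mem_image.1 hy
        exact hseg m (Finset.mem_range.1 hm).le

lemma framePotential_le (hd : 2 ≤ d) {L : ℕ} (hL : 0 < L) {i j p : ℤ × ℤ} (hp : p ∈ frame L i)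
    (hij : 1 ≤ sep i j) : framePotential L j (emb d p) ≤ 8 * (sep i j : ℝ)⁻¹ := by
  have hs : (0 : ℝ) < sep i j := by exact_mod_cast hij
  have hL' : (1 : ℝ) ≤ L := by exact_mod_cast hL
  calc framePotential L j (emb d p) ≤ ∑ _q ∈ frame L j, ((L : ℝ) * sep i j)⁻¹ := by
        refine Finset.sum_le_sum fun q hq => ?_
        rw [emb_sub]
        refine potential_emb_le hd (by positivity) ?_
        have := le_abs_sub_of_mem_frame hp hq
        exact_mod_cast this
    _ = (frame L j).card * ((L : ℝ) * sep i j)⁻¹ := by rw [Finset.sum_const, nsmul_eq_mul]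
    _ ≤ (4 * (L + 1) : ℕ) * ((L : ℝ) * sep i j)⁻¹ := by
        gcongr
        exact card_frame_le L j
    _ ≤ (8 * L) * ((L : ℝ) * sep i j)⁻¹ := by
        refine mul_le_mul_of_nonneg_right ?_ (by positivity)
        push_cast
        linarith
    _ = 8 * (sep i j : ℝ)⁻¹ := by
        rw [mul_inv]
        field_simp

/-- A finite set of indices whose frames are well separated. -/
def IsSpread (X : Finset (ℤ × ℤ)) : Prop :=
  ∀ i ∈ X, (∀ j ∈ X, i ≠ j → 1 ≤ sep i j) ∧ ∑ j ∈ X.erase i, (sep i j : ℝ)⁻¹ ≤ 2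

lemma avg_mul_sum_le {κ : Type*} (T : Finset κ) {f : κ → Zd d → ℝ} {c : ℝ} (hc : 0 ≤ c) (x : Zd d)
    (hf : ∀ k ∈ T, avg (f k) x ≤ f k x) :
    avg (fun x => c * ∑ k ∈ T, f k x) x ≤ c * ∑ k ∈ T, f k x := by
  have : avg (fun x => c * ∑ k ∈ T, f k x) x = c * ∑ k ∈ T, avg (f k) x := by
    unfold avg
    rw [← Finset.mul_sum, ← Finset.mul_sum, Finset.sum_comm]
    ring
  rw [this]
  exact mul_le_mul_of_nonneg_left (Finset.sum_le_sum hf) hc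

lemma avg_framePotential_le (hd : 3 ≤ d) (L : ℕ) (i : ℤ × ℤ) (x : Zd d) :
    avg (framePotential L i) x ≤ framePotential L i x := by
  have := avg_mul_sum_le (frame L i) zero_le_one x fun p _ => avg_potential_sub_le hd (emb d p) x
  simp only [one_mul] at this
  exact this

lemma isBarrier_frame (hd : 3 ≤ d) {M : ℕ} {X : Finset (ℤ × ℤ)} (hX : IsSpread X)
    (hM : 0 < M) :
    IsBarrier X (fun i => ((frame (2 * M) i).image (emb d) : Set (Zd d)))
      (16 * (∑ m ∈ Finset.range M, ((m : ℝ) + 4)⁻¹)⁻¹)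
      (fun i x => (∑ m ∈ Finset.range M, ((m : ℝ) + 4)⁻¹)⁻¹ *
        ∑ j ∈ X.erase i, framePotential (2 * M) j x) := by
  have hS : 0 < ∑ m ∈ Finset.range M, ((m : ℝ) + 4)⁻¹ :=
    Finset.sum_pos (fun m _ => by positivity) ⟨0, Finset.mem_range.2 hM⟩
  set S := ∑ m ∈ Finset.range M, ((m : ℝ) + 4)⁻¹
  refine ⟨fun i x => ?_, fun i x => ?_, fun i hi j _ hij x hx => ?_, fun i hi x hx => ?_⟩
  · exact mul_nonneg (inv_nonneg.2 hS.le) (Finset.sum_nonneg fun j _ => framePotential_nonneg _ _ _)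
  · exact avg_mul_sum_le _ (inv_nonneg.2 hS.le) x fun j _ => avg_framePotential_le hd _ _ _
  · obtain ⟨p, hp, rfl⟩ := Finset.mem_image.1 (Finset.mem_coe.1 hx)
    rw [← div_eq_inv_mul, one_le_div hS]
    exact (le_framePotential (by omega) hp).trans (Finset.single_le_sum
      (f := fun j => framePotential (2 * M) j (emb d p))
      (fun j _ => framePotential_nonneg _ _ _) (Finset.mem_erase.2 ⟨hij, hi⟩))
  · obtain ⟨p, hp, rfl⟩ := Finset.mem_image.1 (Finset.mem_coe.1 hx)
    rw [mul_comm 16]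
    refine mul_le_mul_of_nonneg_left ?_ (inv_nonneg.2 hS.le)
    obtain ⟨h1, h2⟩ := hX i hi
    calc ∑ j ∈ X.erase i, framePotential (2 * M) j (emb d p)
        ≤ ∑ j ∈ X.erase i, 8 * (sep i j : ℝ)⁻¹ :=
          Finset.sum_le_sum fun j hj => framePotential_le (by omega) (by omega) hp
            (h1 j (Finset.mem_of_mem_erase hj) (Finset.ne_of_mem_erase hj).symm)
      _ ≤ 16 := by rw [← Finset.mul_sum]; linarith

lemma disjoint_frame (hd : 2 ≤ d) {L : ℕ} (hL : 0 < L) {i j : ℤ × ℤ} (hij : 1 ≤ sep i j) :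
    Disjoint ((frame L i).image (emb d) : Set (Zd d)) ((frame L j).image (emb d)) := by
  rw [Finset.disjoint_coe, Finset.disjoint_image (emb_injective hd), Finset.disjoint_left]
  intro p hp hq
  have := le_abs_sub_of_mem_frame hp hq
  simp only [sub_self, abs_zero, or_self] at this
  have : 0 < (L : ℤ) * sep i j := by positivity
  omega

lemma tendsto_sum_inv_add_four :
    Tendsto (fun n => ∑ m ∈ Finset.range n, ((m : ℝ) + 4)⁻¹) atTop atTop := by
  refine (not_summable_iff_tendsto_nat_atTop_of_nonneg fun m => by positivity).1 ?_
  have := (summable_nat_add_iff (f := fun n : ℕ => (n : ℝ)⁻¹) 4).not.2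
    Real.not_summable_natCast_inv
  simpa using this

/-- At small levels, occupied points are rare on well-separated large frames. -/
theorem exists_all_occupied_frame_le (hd : 3 ≤ d) {ε : ℝ} (hε : 0 < ε) :
    ∃ L : ℕ, 0 < L ∧ ∃ u : ℝ, 0 < u ∧ ∀ P : Zd d → Measure (ℕ → Zd d), IsSRW d P →
      ∀ Q : Measure (Zd d → Bool), IsVacantLaw P u Q → ∀ X : Finset (ℤ × ℤ), IsSpread X →
        Q.real {Y | ∀ i ∈ X, Y ∈ occupied ((frame L i).image (emb d) : Set (Zd d))} ≤
          ε ^ X.card := by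
  set z := max 1 (Real.exp 1 / ε) with hz
  have hz1 : 1 ≤ z := le_max_left _ _
  obtain ⟨M, hM, hM0⟩ := ((tendsto_sum_inv_add_four.eventually_ge_atTop (32 * z)).and
    (eventually_gt_atTop 0)).exists
  set S := ∑ m ∈ Finset.range M, ((m : ℝ) + 4)⁻¹ with hS
  have hS0 : 0 < S := by linarith
  have hu : (0 : ℝ) < (2 * z * (4 * (2 * M + 1) : ℕ))⁻¹ := by positivity
  refine ⟨2 * M, by omega, (2 * z * (4 * (2 * M + 1) : ℕ))⁻¹, hu, fun P hP Q hQ X hX => ?_⟩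
  have key := hQ.all_occupied_le (F := fun i => (frame (2 * M) i).image (emb d)) (by omega) hP hu.le
    (isBarrier_frame hd hX hM0)
    (fun i hi j hj hij => disjoint_frame (by omega) (by omega) ((hX i hi).1 j hj hij)) hz1 ?_
    (fun i => Finset.card_image_le.trans (card_frame_le _ _))
  · refine key.trans (pow_le_pow_left₀ (by positivity) ?_ _)
    rw [mul_assoc _ (2 * z), inv_mul_cancel₀ (by positivity), inv_mul_le_iff₀ (by positivity)]
    calc Real.exp 1 = Real.exp 1 / ε * ε := by field_simp
      _ ≤ z * ε := by gcongr; exact le_max_right _ _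
  · rw [← hS]
    have : 2 * z * (16 * S⁻¹) = 32 * z / S := by ring
    rw [this, div_le_one hS0]
    exact hM

end Frames

section Recursion

/-- The `8 × 8` boxes of one scale that make up a box of the next scale. -/
noncomputable def children (x : ℤ × ℤ) : Finset (ℤ × ℤ) :=
  Finset.Icc (8 * x.1) (8 * x.1 + 7) ×ˢ Finset.Icc (8 * x.2) (8 * x.2 + 7)

lemma mem_children {x y : ℤ × ℤ} : y ∈ children x ↔
    (8 * x.1 ≤ y.1 ∧ y.1 ≤ 8 * x.1 + 7) ∧ 8 * x.2 ≤ y.2 ∧ y.2 ≤ 8 * x.2 + 7 := by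
  simp [children]

lemma card_children (x : ℤ × ℤ) : (children x).card = 64 := by
  have h : ∀ a : ℤ, (a + 7 + 1 - a).toNat = 8 := fun a => by omega
  simp [children, h]

/-- A box is bad at scale `n + 1` if it contains two separated boxes that are bad at scale `n`. -/
def bad (b : ℤ × ℤ → Prop) : ℕ → ℤ × ℤ → Prop
  | 0, x => b x
  | n + 1, x => ∃ y ∈ children x, ∃ y' ∈ children x, 1 ≤ sep y y' ∧ bad b n y ∧ bad b n y'

/-- The sets of leaves of the binary trees of separated boxes descending from a box. -/
noncomputable def leaves : ℕ → ℤ × ℤ → Finset (Finset (ℤ × ℤ))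
  | 0, x => {{x}}
  | n + 1, x => {p ∈ children x ×ˢ children x | 1 ≤ sep p.1 p.2}.biUnion fun p =>
      Finset.image₂ (fun X X' => X ∪ X') (leaves n p.1) (leaves n p.2)

lemma mem_leaves_succ {n : ℕ} {x : ℤ × ℤ} {X : Finset (ℤ × ℤ)} : X ∈ leaves (n + 1) x ↔
    ∃ y ∈ children x, ∃ y' ∈ children x, 1 ≤ sep y y' ∧
      ∃ Z ∈ leaves n y, ∃ Z' ∈ leaves n y', Z ∪ Z' = X := by
  simp only [leaves, Finset.mem_biUnion, Finset.mem_filter, Finset.mem_product, Finset.mem_image₂]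
  constructor
  · rintro ⟨⟨y, y'⟩, ⟨⟨h1, h2⟩, h3⟩, h4⟩
    exact ⟨y, h1, y', h2, h3, h4⟩
  · rintro ⟨y, h1, y', h2, h3, h4⟩
    exact ⟨(y, y'), ⟨⟨h1, h2⟩, h3⟩, h4⟩

lemma bad.exists_leaves {b : ℤ × ℤ → Prop} {n : ℕ} {x : ℤ × ℤ} (h : bad b n x) :
    ∃ X ∈ leaves n x, ∀ i ∈ X, b i := by
  induction n generalizing x with
  | zero => exact ⟨{x}, by simp [leaves], by simpa using show b x from h⟩
  | succ n ih =>
    obtain ⟨y, hy, y', hy', hs, h1, h2⟩ := h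
    obtain ⟨Z, hZ, hb⟩ := ih h1
    obtain ⟨Z', hZ', hb'⟩ := ih h2
    refine ⟨Z ∪ Z', mem_leaves_succ.2 ⟨y, hy, y', hy', hs, Z, hZ, Z', hZ', rfl⟩, fun i hi => ?_⟩
    exact (Finset.mem_union.1 hi).elim (hb i) (hb' i)

lemma card_leaves_le (n : ℕ) (x : ℤ × ℤ) : (leaves n x).card * 4096 ≤ 4096 ^ 2 ^ n := by
  induction n generalizing x with
  | zero => simp [leaves]
  | succ n ih =>
    have h1 : (leaves (n + 1) x).card ≤ ∑ p ∈ children x ×ˢ children x,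
        (leaves n p.1).card * (leaves n p.2).card := by
      refine Finset.card_biUnion_le.trans ?_
      refine (Finset.sum_le_sum fun p _ => Finset.card_image₂_le _ _ _).trans ?_
      exact Finset.sum_le_sum_of_subset (Finset.filter_subset _ _)
    have h2 : ∀ p : (ℤ × ℤ) × ℤ × ℤ, 4096 ^ 2 * ((leaves n p.1).card * (leaves n p.2).card) ≤
        4096 ^ 2 ^ (n + 1) := fun p => by
      calc _ = (leaves n p.1).card * 4096 * ((leaves n p.2).card * 4096) := by ring
        _ ≤ 4096 ^ 2 ^ n * 4096 ^ 2 ^ n := Nat.mul_le_mul (ih _) (ih _)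
        _ = _ := by ring
    have h3 := Finset.sum_le_sum fun p (_ : p ∈ children x ×ˢ children x) => h2 p
    rw [← Finset.mul_sum, Finset.sum_const, Finset.card_product, card_children, smul_eq_mul] at h3
    omega

lemma mem_box_of_mem_leaves {n : ℕ} {x : ℤ × ℤ} {X : Finset (ℤ × ℤ)} (hX : X ∈ leaves n x)
    {i : ℤ × ℤ} (hi : i ∈ X) : (8 ^ n * x.1 ≤ i.1 ∧ i.1 < 8 ^ n * (x.1 + 1)) ∧
      8 ^ n * x.2 ≤ i.2 ∧ i.2 < 8 ^ n * (x.2 + 1) := by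
  induction n generalizing x X with
  | zero =>
    simp only [leaves, Finset.mem_singleton] at hX
    subst hX
    rw [Finset.mem_singleton.1 hi]
    simp
  | succ n ih =>
    obtain ⟨y, hy, y', hy', -, Z, hZ, Z', hZ', rfl⟩ := mem_leaves_succ.1 hX
    have key : ∀ w ∈ children x, ((8 ^ n * w.1 ≤ i.1 ∧ i.1 < 8 ^ n * (w.1 + 1)) ∧
        8 ^ n * w.2 ≤ i.2 ∧ i.2 < 8 ^ n * (w.2 + 1)) → (8 ^ (n + 1) * x.1 ≤ i.1 ∧
        i.1 < 8 ^ (n + 1) * (x.1 + 1)) ∧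
        8 ^ (n + 1) * x.2 ≤ i.2 ∧ i.2 < 8 ^ (n + 1) * (x.2 + 1) := by
      intro w hw h
      rw [mem_children] at hw
      have h8 : (0 : ℤ) < 8 ^ n := by positivity
      rw [pow_succ]
      refine ⟨⟨?_, ?_⟩, ?_, ?_⟩ <;> nlinarith
    exact (Finset.mem_union.1 hi).elim (fun h => key y hy (ih hZ h)) fun h => key y' hy' (ih hZ' h)

lemma le_sep_of_mem_leaves {n : ℕ} {y y' : ℤ × ℤ} (h : 1 ≤ sep y y') {X X' : Finset (ℤ × ℤ)}
    (hX : X ∈ leaves n y) (hX' : X' ∈ leaves n y') {i j : ℤ × ℤ} (hi : i ∈ X) (hj : j ∈ X') :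
    8 ^ n ≤ sep i j := by
  obtain ⟨⟨h1, h2⟩, h3, h4⟩ := mem_box_of_mem_leaves hX hi
  obtain ⟨⟨h5, h6⟩, h7, h8⟩ := mem_box_of_mem_leaves hX' hj
  have aux : ∀ a b s t : ℤ, 8 ^ n * a ≤ s → s < 8 ^ n * (a + 1) → 8 ^ n * b ≤ t →
      t < 8 ^ n * (b + 1) → 2 ≤ |a - b| → 8 ^ n + 1 ≤ |s - t| := by
    intro a b s t g1 g2 g3 g4 g
    have h8 : (0 : ℤ) < 8 ^ n := by positivity
    rcases le_abs.1 g with g | g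
    · refine le_trans ?_ (le_abs_self _)
      nlinarith
    · refine le_trans ?_ (neg_le_abs _)
      nlinarith
  unfold sep at h ⊢
  rcases max_cases |y.1 - y'.1| |y.2 - y'.2| with ⟨g, _⟩ | ⟨g, _⟩
  · have := (aux _ _ _ _ h1 h2 h5 h6 (by omega)).trans (le_max_left _ |i.2 - j.2|)
    omega
  · have := (aux _ _ _ _ h3 h4 h7 h8 (by omega)).trans (le_max_right |i.1 - j.1| _)
    omega

lemma sep_self (i : ℤ × ℤ) : sep i i = -1 := by simp [sep]

lemma disjoint_of_mem_leaves {n : ℕ} {y y' : ℤ × ℤ} (h : 1 ≤ sep y y') {X X' : Finset (ℤ × ℤ)}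
    (hX : X ∈ leaves n y) (hX' : X' ∈ leaves n y') : Disjoint X X' := by
  refine Finset.disjoint_left.2 fun i hi hi' => ?_
  have := le_sep_of_mem_leaves h hX hX' hi hi'
  rw [sep_self] at this
  have : (0 : ℤ) < 8 ^ n := by positivity
  omega

lemma card_of_mem_leaves {n : ℕ} {x : ℤ × ℤ} {X : Finset (ℤ × ℤ)} (hX : X ∈ leaves n x) :
    X.card = 2 ^ n := by
  induction n generalizing x X with
  | zero =>
    simp only [leaves, Finset.mem_singleton] at hX
    simp [hX]
  | succ n ih =>
    obtain ⟨y, hy, y', hy', hs, Z, hZ, Z', hZ', rfl⟩ := mem_leaves_succ.1 hX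
    rw [Finset.card_union_of_disjoint (disjoint_of_mem_leaves hs hZ hZ'), ih hZ, ih hZ']
    ring

lemma sep_sum_le_of_mem_leaves {n : ℕ} {x : ℤ × ℤ} {X : Finset (ℤ × ℤ)} (hX : X ∈ leaves n x)
    {i : ℤ × ℤ} (hi : i ∈ X) : (∀ j ∈ X, i ≠ j → 1 ≤ sep i j) ∧
      ∑ j ∈ X.erase i, (sep i j : ℝ)⁻¹ ≤ 4 / 3 * (1 - (1 / 4) ^ n) := by
  induction n generalizing x X with
  | zero =>
    simp only [leaves, Finset.mem_singleton] at hX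
    subst hX
    obtain rfl := Finset.mem_singleton.1 hi
    simp only [Finset.mem_singleton]
    exact ⟨fun j hj hij => absurd hj.symm hij, by simp⟩
  | succ n ih =>
    have key : ∀ y y' : ℤ × ℤ, 1 ≤ sep y y' → ∀ Z ∈ leaves n y, ∀ Z' ∈ leaves n y', i ∈ Z →
        (∀ j ∈ Z ∪ Z', i ≠ j → 1 ≤ sep i j) ∧
          ∑ j ∈ (Z ∪ Z').erase i, (sep i j : ℝ)⁻¹ ≤ 4 / 3 * (1 - (1 / 4) ^ (n + 1)) := by
      intro y y' hs Z hZ Z' hZ' hi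
      obtain ⟨h1, h2⟩ := ih hZ hi
      have h3 : ∀ j ∈ Z', 8 ^ n ≤ sep i j := fun j hj => le_sep_of_mem_leaves hs hZ hZ' hi hj
      refine ⟨fun j hj hij => ?_, ?_⟩
      · rcases Finset.mem_union.1 hj with hj | hj
        · exact h1 j hj hij
        · exact (one_le_pow₀ (by norm_num)).trans (h3 j hj)
      · have hd := disjoint_of_mem_leaves hs hZ hZ'
        rw [Finset.erase_union_distrib, Finset.erase_eq_of_notMem (Finset.disjoint_left.1 hd hi),
          Finset.sum_union (hd.mono_left (Finset.erase_subset _ _))]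
        have h4 : ∑ j ∈ Z', (sep i j : ℝ)⁻¹ ≤ (1 / 4) ^ n := by
          calc ∑ j ∈ Z', (sep i j : ℝ)⁻¹ ≤ ∑ _j ∈ Z', ((8 : ℝ) ^ n)⁻¹ :=
                Finset.sum_le_sum fun j hj =>
                  inv_anti₀ (by positivity) (by exact_mod_cast h3 j hj)
            _ = (1 / 4) ^ n := by
                rw [Finset.sum_const, card_of_mem_leaves hZ', nsmul_eq_mul, ← inv_pow]
                push_cast
                rw [← mul_pow]
                norm_num
        have h5 : (1 / 4 : ℝ) ^ (n + 1) = (1 / 4) ^ n / 4 := by ring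
        rw [h5]
        linarith
    obtain ⟨y, hy, y', hy', hs, Z, hZ, Z', hZ', rfl⟩ := mem_leaves_succ.1 hX
    rcases Finset.mem_union.1 hi with hi | hi
    · exact key y y' hs Z hZ Z' hZ' hi
    · rw [Finset.union_comm]
      exact key y' y (by rwa [sep_comm]) Z' hZ' Z hZ hi

lemma isSpread_of_mem_leaves {n : ℕ} {x : ℤ × ℤ} {X : Finset (ℤ × ℤ)} (hX : X ∈ leaves n x) :
    IsSpread X := fun i hi => by
  obtain ⟨h1, h2⟩ := sep_sum_le_of_mem_leaves hX hi
  refine ⟨h1, h2.trans ?_⟩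
  have : (0 : ℝ) ≤ (1 / 4) ^ n := by positivity
  linarith

variable {d : ℕ}

lemma measureReal_bad_le {Q : Measure (Zd d → Bool)} [IsFiniteMeasure Q]
    {E : ℤ × ℤ → Set (Zd d → Bool)} (hE : ∀ X : Finset (ℤ × ℤ), IsSpread X →
      Q.real {Y | ∀ i ∈ X, Y ∈ E i} ≤ (1 / 8192) ^ X.card) (n : ℕ) (x : ℤ × ℤ) :
    Q.real {Y | bad (fun i => Y ∈ E i) n x} ≤ (1 / 2) ^ 2 ^ n := by
  have h1 : {Y | bad (fun i => Y ∈ E i) n x} ⊆ ⋃ X ∈ leaves n x, {Y | ∀ i ∈ X, Y ∈ E i} := by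
    intro Y hY
    obtain ⟨X, hX, h⟩ := bad.exists_leaves hY
    exact Set.mem_biUnion (Finset.mem_coe.2 hX) h
  calc Q.real {Y | bad (fun i => Y ∈ E i) n x}
      ≤ ∑ X ∈ leaves n x, Q.real {Y | ∀ i ∈ X, Y ∈ E i} :=
        (measureReal_mono h1 (measure_ne_top _ _)).trans (measureReal_biUnion_finset_le _ _)
    _ ≤ ∑ _X ∈ leaves n x, (1 / 8192 : ℝ) ^ 2 ^ n := by
        refine Finset.sum_le_sum fun X hX => ?_
        rw [← card_of_mem_leaves hX]
        exact hE X (isSpread_of_mem_leaves hX)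
    _ = (leaves n x).card * (1 / 8192 : ℝ) ^ 2 ^ n := by rw [Finset.sum_const, nsmul_eq_mul]
    _ ≤ (4096 ^ 2 ^ n : ℕ) * (1 / 8192 : ℝ) ^ 2 ^ n := by
        refine mul_le_mul_of_nonneg_right ?_ (by positivity)
        have := card_leaves_le n x
        exact_mod_cast (Nat.le_mul_of_pos_right _ (by norm_num)).trans this
    _ = (1 / 2) ^ 2 ^ n := by
        push_cast
        rw [← mul_pow]
        norm_num

lemma ae_eventually_not_bad {Q : Measure (Zd d → Bool)} [IsFiniteMeasure Q]
    {E : ℤ × ℤ → Set (Zd d → Bool)} (hE : ∀ X : Finset (ℤ × ℤ), IsSpread X →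
      Q.real {Y | ∀ i ∈ X, Y ∈ E i} ≤ (1 / 8192) ^ X.card) (x : ℤ × ℤ) :
    ∀ᵐ Y ∂Q, ∀ᶠ n in atTop, ¬bad (fun i => Y ∈ E i) n x := by
  refine ae_eventually_notMem (s := fun n => {Y | bad (fun i => Y ∈ E i) n x}) ?_
  have h : ∀ n, Q {Y | bad (fun i => Y ∈ E i) n x} ≤ ENNReal.ofReal ((1 / 2) ^ n) := by
    intro n
    rw [← ofReal_measureReal]
    refine ENNReal.ofReal_le_ofReal ((measureReal_bad_le hE n x).trans ?_)
    exact pow_le_pow_of_le_one (by norm_num) (by norm_num) Nat.lt_two_pow_self.le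
  refine ne_top_of_le_ne_top ?_ (ENNReal.tsum_le_tsum h)
  rw [← ENNReal.ofReal_tsum_of_nonneg (fun n => by positivity) summable_geometric_two]
  exact ENNReal.ofReal_ne_top

end Recursion

section Planar

/-- The relation of being connected inside a set of the planar lattice. -/
def Conn (S : Set (ℤ × ℤ)) : ℤ × ℤ → ℤ × ℤ → Prop :=
  Relation.ReflTransGen fun p q => |p.1 - q.1| + |p.2 - q.2| = 1 ∧ p ∈ S ∧ q ∈ S

lemma Conn.trans {S : Set (ℤ × ℤ)} {p q r : ℤ × ℤ} (h : Conn S p q) (h' : Conn S q r) :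
    Conn S p r := Relation.ReflTransGen.trans h h'

lemma Conn.symm {S : Set (ℤ × ℤ)} {p q : ℤ × ℤ} (h : Conn S p q) : Conn S q p := by
  induction h with
  | refl => exact Relation.ReflTransGen.refl
  | tail _ h ih =>
    refine Relation.ReflTransGen.head ?_ ih
    rwa [abs_sub_comm, abs_sub_comm (Prod.snd _), and_comm (b := _ ∈ S)]

lemma conn_of_forall_mem {S : Set (ℤ × ℤ)} {f : ℤ → ℤ × ℤ}
    (hf : ∀ t, |(f t).1 - (f (t + 1)).1| + |(f t).2 - (f (t + 1)).2| = 1) {a b s t : ℤ}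
    (hS : ∀ t, a ≤ t → t ≤ b → f t ∈ S) (hs : a ≤ s ∧ s ≤ b) (ht : a ≤ t ∧ t ≤ b) :
    Conn S (f s) (f t) := by
  have key : ∀ t, a ≤ t → t ≤ b → Conn S (f a) (f t) := by
    intro t hat
    induction t, hat using Int.leInduction with
    | base => exact fun _ => Relation.ReflTransGen.refl
    | succ t hat ih =>
      intro htb
      exact (ih (by omega)).tail ⟨hf t, hS t hat (by omega), hS _ (by omega) htb⟩
  exact (key s hs.1 hs.2).symm.trans (key t ht.1 ht.2)

lemma conn_horizontal {S : Set (ℤ × ℤ)} {a b c s t : ℤ} (hS : ∀ t, a ≤ t → t ≤ b → (t, c) ∈ S)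
    (hs : a ≤ s ∧ s ≤ b) (ht : a ≤ t ∧ t ≤ b) : Conn S (s, c) (t, c) :=
  conn_of_forall_mem (f := fun t => (t, c)) (fun t => by simp) hS hs ht

lemma conn_vertical {S : Set (ℤ × ℤ)} {a b c s t : ℤ} (hS : ∀ t, a ≤ t → t ≤ b → (c, t) ∈ S)
    (hs : a ≤ s ∧ s ≤ b) (ht : a ≤ t ∧ t ≤ b) : Conn S (c, s) (c, t) :=
  conn_of_forall_mem (f := fun t => (c, t)) (fun t => by simp) hS hs ht

lemma conn_frame {S : Set (ℤ × ℤ)} {L : ℕ} {x : ℤ × ℤ} (hS : ∀ p ∈ frame L x, p ∈ S)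
    {p q : ℤ × ℤ} (hp : p ∈ frame L x) (hq : q ∈ frame L x) : Conn S p q := by
  have left : ∀ c, (c = L * x.1 ∨ c = L * x.1 + L) → ∀ t, L * x.2 ≤ t → t ≤ L * x.2 + L →
      (c, t) ∈ S := fun c hc t h1 h2 => hS _ (mem_frame.2 (Or.inl ⟨hc, h1, h2⟩))
  have bottom : ∀ c, (c = L * x.2 ∨ c = L * x.2 + L) → ∀ t, L * x.1 ≤ t → t ≤ L * x.1 + L →
      (t, c) ∈ S := fun c hc t h1 h2 => hS _ (mem_frame.2 (Or.inr ⟨⟨h1, h2⟩, hc⟩))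
  have key : ∀ p ∈ frame L x, Conn S p (L * x.1, L * x.2) := by
    rintro ⟨s, t⟩ h
    rcases mem_frame.1 h with ⟨h1, h2⟩ | ⟨h1, h2⟩
    · exact (conn_vertical (left s h1) h2 (t := L * x.2) (by omega)).trans
        (conn_horizontal (bottom _ (Or.inl rfl)) (by simp only at h1; omega) (by omega))
    · exact (conn_horizontal (bottom t h2) h1 (t := L * x.1) (by omega)).trans
        (conn_vertical (left _ (Or.inl rfl)) (by simp only at h2; omega) (by omega))
  exact (key p hp).trans (key q hq).symm

/-- The children of a box that lie in a row or a column without bad children. -/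
def core (b : ℤ × ℤ → Prop) (x : ℤ × ℤ) : Set (ℤ × ℤ) :=
  {y | y ∈ children x ∧ ((∀ y' ∈ children x, y'.1 = y.1 → ¬b y') ∨
    ∀ y' ∈ children x, y'.2 = y.2 → ¬b y')}

variable {b : ℤ × ℤ → Prop} {x : ℤ × ℤ}

lemma not_of_mem_core {y : ℤ × ℤ} (hy : y ∈ core b x) : ¬b y :=
  hy.2.elim (fun h => h y hy.1 rfl) fun h => h y hy.1 rfl

lemma exists_close_of_sep
    (hx : ¬∃ y ∈ children x, ∃ y' ∈ children x, 1 ≤ sep y y' ∧ b y ∧ b y') :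
    ∃ s : ℤ × ℤ, ∀ y ∈ children x, b y → |y.1 - s.1| ≤ 1 ∧ |y.2 - s.2| ≤ 1 := by
  by_cases h : ∃ y ∈ children x, b y
  · obtain ⟨s, hs, hbs⟩ := h
    refine ⟨s, fun y hy hby => ?_⟩
    by_contra hc
    refine hx ⟨y, hy, s, hs, ?_, hby, hbs⟩
    have h1 := le_max_left |y.1 - s.1| |y.2 - s.2|
    have h2 := le_max_right |y.1 - s.1| |y.2 - s.2|
    unfold sep
    omega
  · exact ⟨0, fun y hy hby => absurd ⟨y, hy, hby⟩ h⟩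

lemma exists_mem_core_forall_conn
    (hx : ¬∃ y ∈ children x, ∃ y' ∈ children x, 1 ≤ sep y y' ∧ b y ∧ b y') :
    ∃ z ∈ core b x, ∀ y ∈ core b x, Conn (core b x) y z := by
  obtain ⟨s, hs⟩ := exists_close_of_sep hx
  have far : ∀ m r : ℤ, ∃ c, 8 * m ≤ c ∧ c ≤ 8 * m + 7 ∧ 1 < |c - r| := by
    intro m r
    by_cases h : 8 * m + 1 < r
    · exact ⟨8 * m, by omega, by omega, by rw [lt_abs]; omega⟩
    · exact ⟨8 * m + 7, by omega, by omega, by rw [lt_abs]; omega⟩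
  obtain ⟨c, hc1, hc2, hc⟩ := far x.1 s.1
  obtain ⟨r, hr1, hr2, hr⟩ := far x.2 s.2
  have col : ∀ y ∈ children x, y.1 = c → y ∈ core b x := fun y hy hyc =>
    ⟨hy, Or.inl fun y' hy' h hb => by have := (hs y' hy' hb).1; rw [h, hyc] at this; omega⟩
  have row : ∀ y ∈ children x, y.2 = r → y ∈ core b x := fun y hy hyr =>
    ⟨hy, Or.inr fun y' hy' h hb => by have := (hs y' hy' hb).2; rw [h, hyr] at this; omega⟩
  refine ⟨(c, r), col _ (mem_children.2 ⟨⟨hc1, hc2⟩, hr1, hr2⟩) rfl, ?_⟩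
  rintro ⟨p, q⟩ ⟨hy, hclean⟩
  obtain ⟨hp, hq⟩ := mem_children.1 hy
  rcases hclean with h | h
  · refine (conn_vertical (a := 8 * x.2) (b := 8 * x.2 + 7) (fun t h1 h2 => ?_) hq
      (t := r) ⟨hr1, hr2⟩).trans (conn_horizontal (a := 8 * x.1) (b := 8 * x.1 + 7)
        (fun t h1 h2 => row _ (mem_children.2 ⟨⟨h1, h2⟩, hr1, hr2⟩) rfl) hp ⟨hc1, hc2⟩)
    exact ⟨mem_children.2 ⟨hp, h1, h2⟩, Or.inl h⟩
  · refine (conn_horizontal (a := 8 * x.1) (b := 8 * x.1 + 7) (fun t h1 h2 => ?_) hp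
      (t := c) ⟨hc1, hc2⟩).trans (conn_vertical (a := 8 * x.2) (b := 8 * x.2 + 7)
        (fun t h1 h2 => col _ (mem_children.2 ⟨⟨hc1, hc2⟩, h1, h2⟩) rfl) hq ⟨hr1, hr2⟩)
    exact ⟨mem_children.2 ⟨⟨h1, h2⟩, hq⟩, Or.inr h⟩

lemma exists_adjacent_cores {x' : ℤ × ℤ}
    (hx : ¬∃ y ∈ children x, ∃ y' ∈ children x, 1 ≤ sep y y' ∧ b y ∧ b y')
    (hx' : ¬∃ y ∈ children x', ∃ y' ∈ children x', 1 ≤ sep y y' ∧ b y ∧ b y')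
    (hadj : |x.1 - x'.1| + |x.2 - x'.2| = 1) :
    ∃ y ∈ core b x, ∃ y' ∈ core b x', |y.1 - y'.1| + |y.2 - y'.2| = 1 := by
  obtain ⟨s, hs⟩ := exists_close_of_sep hx
  obtain ⟨s', hs'⟩ := exists_close_of_sep hx'
  have far : ∀ m r r' : ℤ, ∃ c, (8 * m ≤ c ∧ c ≤ 8 * m + 7) ∧ 1 < |c - r| ∧ 1 < |c - r'| := by
    intro m r r'
    by_contra! h
    have h1 := h (8 * m) (by omega)
    have h2 := h (8 * m + 3) (by omega)
    have h3 := h (8 * m + 6) (by omega)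
    simp only [lt_abs, abs_le] at h1 h2 h3
    omega
  have row : ∀ (x s : ℤ × ℤ), (∀ y ∈ children x, b y → |y.1 - s.1| ≤ 1 ∧ |y.2 - s.2| ≤ 1) →
      ∀ y ∈ children x, 1 < |y.2 - s.2| → y ∈ core b x := fun x s hs y hy hr =>
    ⟨hy, Or.inr fun y' hy' h hb => by have := (hs y' hy' hb).2; rw [h] at this; omega⟩
  have col : ∀ (x s : ℤ × ℤ), (∀ y ∈ children x, b y → |y.1 - s.1| ≤ 1 ∧ |y.2 - s.2| ≤ 1) →
      ∀ y ∈ children x, 1 < |y.1 - s.1| → y ∈ core b x := fun x s hs y hy hr =>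
    ⟨hy, Or.inl fun y' hy' h hb => by have := (hs y' hy' hb).1; rw [h] at this; omega⟩
  have hcases : (x.2 = x'.2 ∧ (x'.1 = x.1 + 1 ∨ x.1 = x'.1 + 1)) ∨
      (x.1 = x'.1 ∧ (x'.2 = x.2 + 1 ∨ x.2 = x'.2 + 1)) := by
    rcases abs_cases (x.1 - x'.1) with ⟨h1, _⟩ | ⟨h1, _⟩ <;>
    rcases abs_cases (x.2 - x'.2) with ⟨h2, _⟩ | ⟨h2, _⟩ <;> omega
  rcases hcases with ⟨h2, h1⟩ | ⟨h1, h2⟩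
  · obtain ⟨r, hr, hrs, hrs'⟩ := far x.2 s.2 s'.2
    rcases h1 with h1 | h1
    · exact ⟨(8 * x.1 + 7, r), row x s hs _ (mem_children.2 (by simp only; omega)) hrs,
        (8 * x.1 + 8, r), row x' s' hs' _ (mem_children.2 (by simp only; omega)) hrs', by simp⟩
    · exact ⟨(8 * x'.1 + 8, r), row x s hs _ (mem_children.2 (by simp only; omega)) hrs,
        (8 * x'.1 + 7, r), row x' s' hs' _ (mem_children.2 (by simp only; omega)) hrs', by simp⟩
  · obtain ⟨r, hr, hrs, hrs'⟩ := far x.1 s.1 s'.1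
    rcases h2 with h2 | h2
    · exact ⟨(r, 8 * x.2 + 7), col x s hs _ (mem_children.2 (by simp only; omega)) hrs,
        (r, 8 * x.2 + 8), col x' s' hs' _ (mem_children.2 (by simp only; omega)) hrs', by simp⟩
    · exact ⟨(r, 8 * x'.2 + 8), col x s hs _ (mem_children.2 (by simp only; omega)) hrs,
        (r, 8 * x'.2 + 7), col x' s' hs' _ (mem_children.2 (by simp only; omega)) hrs', by simp⟩

/-- The part of a box that is connected to its well-placed good descendants. -/
def backbone (L : ℕ) (b : ℤ × ℤ → Prop) : ℕ → ℤ × ℤ → Set (ℤ × ℤ)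
  | 0, x => frame L x
  | n + 1, x => {p | ∃ y ∈ core (bad b n) x, p ∈ backbone L b n y}

variable {L : ℕ} {V : Set (ℤ × ℤ)}

lemma backbone_subset (hV : ∀ x, ¬b x → ∀ p ∈ frame L x, p ∈ V) {n : ℕ} (hx : ¬bad b n x) :
    backbone L b n x ⊆ V := by
  induction n generalizing x with
  | zero => exact fun p hp => hV x hx p hp
  | succ n ih =>
    rintro p ⟨y, hy, hp⟩
    exact ih (not_of_mem_core hy) hp

lemma backbone_inter_nonempty {n : ℕ} {x' : ℤ × ℤ} (hx : ¬bad b n x) (hx' : ¬bad b n x')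
    (hadj : |x.1 - x'.1| + |x.2 - x'.2| = 1) :
    (backbone L b n x ∩ backbone L b n x').Nonempty := by
  induction n generalizing x x' with
  | zero =>
    have hcases : (x.2 = x'.2 ∧ (x'.1 = x.1 + 1 ∨ x.1 = x'.1 + 1)) ∨
        (x.1 = x'.1 ∧ (x'.2 = x.2 + 1 ∨ x.2 = x'.2 + 1)) := by
      rcases abs_cases (x.1 - x'.1) with ⟨h1, _⟩ | ⟨h1, _⟩ <;>
      rcases abs_cases (x.2 - x'.2) with ⟨h2, _⟩ | ⟨h2, _⟩ <;> omega
    have hL : (0 : ℤ) ≤ L := by positivity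
    refine ⟨(L * max x.1 x'.1, L * max x.2 x'.2), mem_frame.2 ?_, mem_frame.2 ?_⟩ <;>
    rcases hcases with ⟨h2, h1 | h1⟩ | ⟨h1, h2 | h2⟩ <;> simp [h1, h2, mul_add, hL]
  | succ n ih =>
    obtain ⟨y, hy, y', hy', h⟩ := exists_adjacent_cores hx hx' hadj
    obtain ⟨p, hp, hp'⟩ := ih (not_of_mem_core hy) (not_of_mem_core hy') h
    exact ⟨p, ⟨y, hy, hp⟩, y', hy', hp'⟩

lemma backbone_nonempty {n : ℕ} (hx : ¬bad b n x) : (backbone L b n x).Nonempty := by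
  induction n generalizing x with
  | zero => exact ⟨(L * x.1, L * x.2), mem_frame.2 (by simp)⟩
  | succ n ih =>
    obtain ⟨y, hy, -⟩ := exists_mem_core_forall_conn hx
    obtain ⟨p, hp⟩ := ih (not_of_mem_core hy)
    exact ⟨p, y, hy, hp⟩

lemma conn_backbone (hV : ∀ x, ¬b x → ∀ p ∈ frame L x, p ∈ V) {n : ℕ} (hx : ¬bad b n x)
    {p q : ℤ × ℤ} (hp : p ∈ backbone L b n x) (hq : q ∈ backbone L b n x) : Conn V p q := by
  induction n generalizing x p q with
  | zero => exact conn_frame (hV x hx) hp hq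
  | succ n ih =>
    have chain : ∀ {y y' : ℤ × ℤ}, Conn (core (bad b n) x) y y' → y' ∈ core (bad b n) x →
        ∀ p ∈ backbone L b n y, ∀ q ∈ backbone L b n y', Conn V p q := by
      intro y y' h
      induction h with
      | refl => exact fun hy p hp q hq => ih (not_of_mem_core hy) hp hq
      | tail _ h ih' =>
        intro _ p hp q hq
        obtain ⟨hadj, h1, h2⟩ := h
        obtain ⟨r, hr, hr'⟩ := backbone_inter_nonempty (L := L) (not_of_mem_core h1)
          (not_of_mem_core h2) hadj
        exact (ih' h1 p hp r hr).trans (ih (not_of_mem_core h2) hr' hq)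
    obtain ⟨z, hz, hconn⟩ := exists_mem_core_forall_conn hx
    obtain ⟨y, hy, hp⟩ := hp
    obtain ⟨y', hy', hq⟩ := hq
    exact chain ((hconn y hy).trans (hconn y' hy').symm) hy' p hp q hq

lemma le_fst_of_mem_backbone {n : ℕ} {p : ℤ × ℤ} (hp : p ∈ backbone L b n x) :
    L * (8 ^ n * x.1) ≤ p.1 := by
  induction n generalizing x with
  | zero =>
    rcases mem_frame.1 hp with ⟨h, -⟩ | ⟨h, -⟩
    · rw [pow_zero, one_mul]; omega
    · rw [pow_zero, one_mul]; omega
  | succ n ih =>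
    obtain ⟨y, hy, hp⟩ := hp
    refine le_trans ?_ (ih hp)
    rw [pow_succ, mul_assoc]
    have := (mem_children.1 hy.1).1.1
    gcongr

/-- If all boxes of large scales near the origin are good, the planar set `V` has an infinite
connected component. -/
theorem exists_conn_unbounded (hL : 0 < L) (hV : ∀ x, ¬b x → ∀ p ∈ frame L x, p ∈ V)
    (hgood : ∀ᶠ n in atTop, ∀ x ∈ children 0, ¬bad b n x) :
    ∃ p ∈ V, ∀ m : ℕ, ∃ q, Conn V p q ∧ (m : ℤ) < q.1 := by
  obtain ⟨N, hN⟩ := eventually_atTop.1 hgood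
  have h0 : (0 : ℤ × ℤ) ∈ children 0 := mem_children.2 (by simp)
  have h1 : ((1, 0) : ℤ × ℤ) ∈ children 0 := mem_children.2 (by simp)
  have hsub : ∀ n ≥ N, ∀ y ∈ children 0, backbone L b n y ⊆ backbone L b (n + 1) 0 :=
    fun n hn y hy p hp => ⟨y, ⟨hy, Or.inl fun y' hy' _ => hN n hn y' hy'⟩, hp⟩
  obtain ⟨p, hp⟩ := backbone_nonempty (L := L) (hN N le_rfl 0 h0)
  have hpn : ∀ n ≥ N, p ∈ backbone L b n 0 := by
    intro n hn
    induction n, hn using Nat.le_induction with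
    | base => exact hp
    | succ n hn ih => exact hsub n hn 0 h0 ih
  refine ⟨p, backbone_subset hV (hN N le_rfl 0 h0) hp, fun m => ?_⟩
  have hn : N ≤ N + m := by omega
  obtain ⟨q, hq⟩ := backbone_nonempty (L := L) (hN (N + m) hn _ h1)
  refine ⟨q, conn_backbone hV (hN (N + m + 1) (by omega) 0 h0) (hpn _ (by omega))
    (hsub _ hn _ h1 hq), ?_⟩
  have h2 := le_fst_of_mem_backbone hq
  have h3 : m < 8 ^ (N + m) := (by omega : m ≤ N + m).trans_lt (Nat.lt_pow_self (by norm_num))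
  have h4 : 8 ^ (N + m) ≤ L * 8 ^ (N + m) := Nat.le_mul_of_pos_left _ hL
  have h5 : (m : ℤ) < L * 8 ^ (N + m) := by exact_mod_cast h3.trans_le h4
  simp only [mul_one] at h2
  omega

end Planar

end RI

/-- **Percolation of the vacant set in the plane for small `u`** (Theorem 3.4).
For `d ≥ 3` there exists `u > 0` such that, for every vacant-set law `Q` at level `u`,
`Q`-almost surely the set `{x ∈ ℤ² : Y_x = 1}` contains an infinite nearest-neighbour
connected component. -/
theorem vacant_set_percolates_in_plane (d : ℕ) (hd : 3 ≤ d) :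
    ∃ u : ℝ, 0 < u ∧
      ∀ (P : Zd d → Measure (ℕ → Zd d)), IsSRW d P →
        ∀ Q : Measure (Zd d → Bool), IsVacantLaw P u Q →
          ∀ᵐ Y ∂Q, ∃ x : Zd d,
            x ∈ {z : Zd d | inPlane z ∧ Y z = true} ∧
            (component {z : Zd d | inPlane z ∧ Y z = true} x).Infinite := by
  obtain ⟨L, hL, u, hu, h⟩ := exists_all_occupied_frame_le hd (ε := 1 / 8192) (by norm_num)
  refine ⟨u, hu, fun P hP Q hQ => ?_⟩
  have := hQ.1
  have hgood : ∀ᵐ Y ∂Q, ∀ x ∈ children 0, ∀ᶠ n in atTop,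
      ¬bad (fun i => Y ∈ occupied ((frame L i).image (emb d) : Set (Zd d))) n x :=
    (Finset.eventually_all _).2 fun x _ => ae_eventually_not_bad (h P hP Q hQ) x
  filter_upwards [hgood] with Y hY
  set V : Set (ℤ × ℤ) := {p | Y (emb d p) = true}
  obtain ⟨p, hp, hconn⟩ := exists_conn_unbounded (V := V) hL (fun x hx p hp => by
    by_contra hY
    refine hx ⟨emb d p, Finset.mem_coe.2 (Finset.mem_image_of_mem _ hp), ?_⟩
    exact Bool.eq_false_iff.2 hY) ((Finset.eventually_all _).2 hY)
  refine ⟨emb d p, ⟨inPlane_emb p, hp⟩, fun hfin => ?_⟩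
  obtain ⟨m, hm⟩ := (hfin.image fun x => x ⟨0, by omega⟩).bddAbove
  obtain ⟨q, hq, hlt⟩ := hconn m.toNat
  have hmem : emb d q ∈ component {z : Zd d | inPlane z ∧ Y z = true} (emb d p) :=
    Relation.ReflTransGen.lift
      (p := fun x y => adj x y ∧ x ∈ {z : Zd d | inPlane z ∧ Y z = true} ∧
        y ∈ {z : Zd d | inPlane z ∧ Y z = true}) (emb d)
      (fun a b hab => ⟨(adj_emb (by omega) a b).2 hab.1, ⟨inPlane_emb a, hab.2.1⟩,
        inPlane_emb b, hab.2.2⟩) p q hq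
  have := hm (Set.mem_image_of_mem _ hmem)
  simp only [emb, if_true] at this
  omega
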